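/- arXiv:0707.0532 — 3 statements merged into one kernel-verified Lean document; each statement's English description precedes it below -/
import Mathlib

section
/- ∑_{λ ∈ Y} F_λ(q,t) s^{|λ|} = ∏_{i=1}^{∞} (t s^i; q)_∞ / (s^i; q)_∞, where the sum is over all ordinary partitions and F_λ(q,t) = ∏_{i≥1} ∏_{j=1}^{d_i} (1 - t q^{j-1}) / (1 - q^j) with d_i = λ_i - λ_{i+1}, as an identity of formal power series in s with coefficients rational functions of q and t (equivalently, for real 0 ≤ q, t, s < 1). -/
open scoped BigOperators

/-- An ordinary partition `λ = (λ₁ ≥ λ₂ ≥ …)` with finitely many nonzero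
parts; `part i` is the part `λ_{i+1}` (indexing from `0`). -/
structure NatPartition where
  part : ℕ → ℕ
  decr : ∀ i, part (i + 1) ≤ part i
  finite_supp : {i : ℕ | part i ≠ 0}.Finite

namespace NatPartition

/-- The weight `|λ|`: the sum of the parts. -/
noncomputable def weight (l : NatPartition) : ℕ := ∑ᶠ i : ℕ, l.part i

/-- `k(λ)`: the number of distinct nonzero parts of `λ`. -/
noncomputable def distinctParts (l : NatPartition) : ℕ :=
  {n : ℕ | n ≠ 0 ∧ ∃ i, l.part i = n}.ncard

end NatPartition

/-- The infinite `q`-Pochhammer symbol `(x; q)_∞ = ∏_{n ≥ 0} (1 - x qⁿ)`. -/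
noncomputable def qPoch (x q : ℝ) : ℝ := ∏' n : ℕ, (1 - x * q ^ n)

open Filter Topology Finset

/-- The coefficient `∏_{j < d} (1 - t qʲ) / (1 - q^{j+1})` of the `q`-binomial series. -/
noncomputable def qBinomCoeff (q t : ℝ) (d : ℕ) : ℝ :=
  ∏ j ∈ range d, (1 - t * q ^ j) / (1 - q ^ (j + 1))

/-- The `q`-binomial series `∑_d (t;q)_d / (q;q)_d x^d`. -/
noncomputable def qBinomSeries (q t x : ℝ) : ℝ := ∑' d : ℕ, qBinomCoeff q t d * x ^ d

section QBinomial

variable {q t x : ℝ}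

lemma qBinomCoeff_pos (hq0 : 0 ≤ q) (hq1 : q < 1) (ht0 : 0 ≤ t) (ht1 : t < 1) (d : ℕ) :
    0 < qBinomCoeff q t d := by
  refine prod_pos fun j _ => div_pos ?_ ?_
  · have := pow_le_one₀ (n := j) hq0 hq1.le
    nlinarith [pow_nonneg hq0 j]
  · exact sub_pos.2 (pow_lt_one₀ hq0 hq1 (Nat.succ_ne_zero j))

lemma qBinomCoeff_succ (q t : ℝ) (d : ℕ) :
    qBinomCoeff q t (d + 1) = (1 - t * q ^ d) / (1 - q ^ (d + 1)) * qBinomCoeff q t d := by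
  rw [qBinomCoeff, prod_range_succ, mul_comm, qBinomCoeff]

lemma tendsto_qBinomCoeff_ratio (hq0 : 0 ≤ q) (hq1 : q < 1) (t : ℝ) :
    Tendsto (fun d : ℕ => (1 - t * q ^ d) / (1 - q ^ (d + 1))) atTop (𝓝 1) := by
  have h := tendsto_pow_atTop_nhds_zero_of_lt_one hq0 hq1
  have h1 : Tendsto (fun d : ℕ => 1 - t * q ^ d) atTop (𝓝 (1 - t * 0)) :=
    tendsto_const_nhds.sub (h.const_mul t)
  have h2 : Tendsto (fun d : ℕ => 1 - q ^ (d + 1)) atTop (𝓝 (1 - 0)) :=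
    tendsto_const_nhds.sub ((tendsto_add_atTop_iff_nat 1).2 h)
  have h3 := h1.div h2 (by simp)
  simp only [mul_zero, sub_zero, div_one] at h3
  exact h3

lemma summable_mul_pow_of_ratio_tendsto_one {b r : ℕ → ℝ} (hb : ∀ n, b (n + 1) = r n * b n)
    (hr : Tendsto r atTop (𝓝 1)) (hx : |x| < 1) : Summable fun n => b n * x ^ n := by
  obtain ⟨c, hxc, hc⟩ := exists_between hx
  refine summable_of_ratio_norm_eventually_le hc ?_
  have h : Tendsto (fun n => |r n| * |x|) atTop (𝓝 (|1| * |x|)) := hr.abs.mul_const _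
  rw [abs_one, one_mul] at h
  filter_upwards [h.eventually_lt_const hxc] with n hn
  rw [hb, pow_succ]
  simp only [norm_mul, Real.norm_eq_abs]
  have : 0 ≤ |b n| * |x ^ n| := by positivity
  nlinarith

lemma summable_qBinomSeries (hq0 : 0 ≤ q) (hq1 : q < 1) (hx : |x| < 1) :
    Summable fun d => qBinomCoeff q t d * x ^ d :=
  summable_mul_pow_of_ratio_tendsto_one (qBinomCoeff_succ q t)
    (tendsto_qBinomCoeff_ratio hq0 hq1 t) hx

lemma summable_qBinomCoeff_succ_mul_pow (hq0 : 0 ≤ q) (hq1 : q < 1) (hx : |x| < 1) :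
    Summable fun d => qBinomCoeff q t (d + 1) * x ^ d :=
  summable_mul_pow_of_ratio_tendsto_one (fun d => qBinomCoeff_succ q t (d + 1))
    ((tendsto_add_atTop_iff_nat 1).2 (tendsto_qBinomCoeff_ratio hq0 hq1 t)) hx

lemma qBinomSeries_eq_one_add (hq0 : 0 ≤ q) (hq1 : q < 1) (hx : |x| < 1) :
    qBinomSeries q t x = 1 + x * ∑' d : ℕ, qBinomCoeff q t (d + 1) * x ^ d := by
  rw [qBinomSeries, (summable_qBinomSeries hq0 hq1 hx).tsum_eq_zero_add, ← tsum_mul_left]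
  congr 1
  · simp [qBinomCoeff]
  · exact tsum_congr fun d => by ring

lemma one_le_qBinomSeries (hq0 : 0 ≤ q) (hq1 : q < 1) (ht0 : 0 ≤ t) (ht1 : t < 1)
    (hx0 : 0 ≤ x) (hx1 : x < 1) : 1 ≤ qBinomSeries q t x := by
  rw [qBinomSeries_eq_one_add hq0 hq1 (abs_lt.2 ⟨by linarith, hx1⟩), le_add_iff_nonneg_right]
  exact mul_nonneg hx0 <| tsum_nonneg fun d =>
    mul_nonneg (qBinomCoeff_pos hq0 hq1 ht0 ht1 _).le (pow_nonneg hx0 d)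

lemma qBinomSeries_sub_one_le (hq0 : 0 ≤ q) (hq1 : q < 1) (ht0 : 0 ≤ t) (ht1 : t < 1)
    {y : ℝ} (hy0 : 0 ≤ y) (hyx : y ≤ x) (hx1 : x < 1) :
    qBinomSeries q t y - 1 ≤ y * ∑' d : ℕ, qBinomCoeff q t (d + 1) * x ^ d := by
  have hy : |y| < 1 := abs_lt.2 ⟨by linarith, by linarith⟩
  have hx : |x| < 1 := abs_lt.2 ⟨by linarith, hx1⟩
  rw [qBinomSeries_eq_one_add hq0 hq1 hy, add_sub_cancel_left]
  refine mul_le_mul_of_nonneg_left ?_ hy0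
  refine (summable_qBinomCoeff_succ_mul_pow hq0 hq1 hy).tsum_le_tsum (fun d => ?_)
    (summable_qBinomCoeff_succ_mul_pow hq0 hq1 hx)
  exact mul_le_mul_of_nonneg_left (pow_le_pow_left₀ hy0 hyx d)
    (qBinomCoeff_pos hq0 hq1 ht0 ht1 _).le

lemma one_sub_mul_qBinomSeries (hq0 : 0 ≤ q) (hq1 : q < 1) (hx : |x| < 1) :
    (1 - x) * qBinomSeries q t x = (1 - t * x) * qBinomSeries q t (x * q) := by
  have hxq : |x * q| < 1 := by
    rw [abs_mul, abs_of_nonneg hq0]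
    nlinarith [abs_nonneg x]
  have hs := summable_qBinomSeries (t := t) hq0 hq1 hx
  have hsq := summable_qBinomSeries (t := t) hq0 hq1 hxq
  have h : qBinomSeries q t x - qBinomSeries q t (x * q) =
      x * (qBinomSeries q t x - t * qBinomSeries q t (x * q)) := by
    simp only [qBinomSeries]
    rw [← hs.tsum_sub hsq, ← tsum_mul_left, ← hs.tsum_sub (hsq.mul_left t),
      (hs.sub hsq).tsum_eq_zero_add, ← tsum_mul_left]
    simp only [pow_zero, sub_self, zero_add]
    refine tsum_congr fun d => ?_
    have hd : 1 - q ^ (d + 1) ≠ 0 := (sub_pos.2 (pow_lt_one₀ hq0 hq1 (Nat.succ_ne_zero d))).ne'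
    have hc : qBinomCoeff q t (d + 1) * (1 - q ^ (d + 1)) =
        (1 - t * q ^ d) * qBinomCoeff q t d := by
      rw [qBinomCoeff_succ]
      field_simp
    rw [mul_pow, mul_pow]
    linear_combination x ^ (d + 1) * hc
  linear_combination h

lemma tendsto_qBinomSeries_mul_pow (hq0 : 0 ≤ q) (hq1 : q < 1) (ht0 : 0 ≤ t) (ht1 : t < 1)
    (hx0 : 0 ≤ x) (hx1 : x < 1) :
    Tendsto (fun n : ℕ => qBinomSeries q t (x * q ^ n)) atTop (𝓝 1) := by
  have h : Tendsto (fun n : ℕ => 1 + x * q ^ n * ∑' d : ℕ, qBinomCoeff q t (d + 1) * x ^ d)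
      atTop (𝓝 (1 + x * 0 * ∑' d : ℕ, qBinomCoeff q t (d + 1) * x ^ d)) :=
    (((tendsto_pow_atTop_nhds_zero_of_lt_one hq0 hq1).const_mul x).mul_const _).const_add 1
  rw [mul_zero, zero_mul, add_zero] at h
  have hle : ∀ n : ℕ, x * q ^ n ≤ x := fun n =>
    mul_le_of_le_one_right hx0 (pow_le_one₀ hq0 hq1.le)
  have hnn : ∀ n : ℕ, 0 ≤ x * q ^ n := fun n => mul_nonneg hx0 (pow_nonneg hq0 n)
  refine tendsto_of_tendsto_of_tendsto_of_le_of_le tendsto_const_nhds h (fun n => ?_) fun n => ?_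
  · exact one_le_qBinomSeries hq0 hq1 ht0 ht1 (hnn n) ((hle n).trans_lt hx1)
  · linarith [qBinomSeries_sub_one_le hq0 hq1 ht0 ht1 (hnn n) (hle n) hx1]

lemma tendsto_prod_range_qPoch (hq0 : 0 ≤ q) (hq1 : q < 1) (x : ℝ) :
    Tendsto (fun N : ℕ => ∏ n ∈ range N, (1 - x * q ^ n)) atTop (𝓝 (qPoch x q)) := by
  have hs : Summable fun n : ℕ => ‖-(x * q ^ n)‖ :=
    ((summable_geometric_of_lt_one hq0 hq1).mul_left x).neg.norm
  simpa only [← sub_eq_add_neg, qPoch] using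
    (multipliable_one_add_of_summable hs).hasProd.tendsto_prod_nat

lemma prod_range_mul_qBinomSeries (hq0 : 0 ≤ q) (hq1 : q < 1) (hx0 : 0 ≤ x) (hx1 : x < 1)
    (N : ℕ) :
    (∏ n ∈ range N, (1 - x * q ^ n)) * qBinomSeries q t x =
      (∏ n ∈ range N, (1 - t * x * q ^ n)) * qBinomSeries q t (x * q ^ N) := by
  induction N with
  | zero => simp
  | succ N ih =>
    have hx : |x * q ^ N| < 1 := by
      rw [abs_of_nonneg (mul_nonneg hx0 (pow_nonneg hq0 N))]
      exact (mul_le_of_le_one_right hx0 (pow_le_one₀ hq0 hq1.le)).trans_lt hx1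
    have h := one_sub_mul_qBinomSeries (t := t) hq0 hq1 hx
    rw [prod_range_succ, prod_range_succ, pow_succ, ← mul_assoc x]
    linear_combination (1 - x * q ^ N) * ih + (∏ n ∈ range N, (1 - t * x * q ^ n)) * h

lemma qPoch_mul_qBinomSeries (hq0 : 0 ≤ q) (hq1 : q < 1) (ht0 : 0 ≤ t) (ht1 : t < 1)
    (hx0 : 0 ≤ x) (hx1 : x < 1) : qPoch x q * qBinomSeries q t x = qPoch (t * x) q := by
  have h1 := (tendsto_prod_range_qPoch hq0 hq1 x).mul_const (qBinomSeries q t x)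
  have h2 := (tendsto_prod_range_qPoch hq0 hq1 (t * x)).mul
    (tendsto_qBinomSeries_mul_pow hq0 hq1 ht0 ht1 hx0 hx1)
  simp only [prod_range_mul_qBinomSeries hq0 hq1 hx0 hx1] at h1
  simpa using tendsto_nhds_unique h1 h2

lemma qPoch_ne_zero (hq0 : 0 ≤ q) (hq1 : q < 1) (hx0 : 0 ≤ x) (hx1 : x < 1) :
    qPoch x q ≠ 0 := by
  intro h
  have := qPoch_mul_qBinomSeries hq0 hq1 le_rfl zero_lt_one hx0 hx1
  rw [h, zero_mul, zero_mul] at this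
  simp [qPoch] at this

/-- The `q`-binomial theorem. -/
lemma qBinomSeries_eq_div (hq0 : 0 ≤ q) (hq1 : q < 1) (ht0 : 0 ≤ t) (ht1 : t < 1)
    (hx0 : 0 ≤ x) (hx1 : x < 1) : qBinomSeries q t x = qPoch (t * x) q / qPoch x q := by
  rw [eq_div_iff (qPoch_ne_zero hq0 hq1 hx0 hx1), mul_comm,
    qPoch_mul_qBinomSeries hq0 hq1 ht0 ht1 hx0 hx1]

lemma tendsto_prod_range_qBinomSeries (hq0 : 0 ≤ q) (hq1 : q < 1) (ht0 : 0 ≤ t) (ht1 : t < 1)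
    {s : ℝ} (hs0 : 0 ≤ s) (hs1 : s < 1) :
    Tendsto (fun N : ℕ => ∏ i ∈ range N, qBinomSeries q t (s ^ (i + 1))) atTop
      (𝓝 (∏' i : ℕ, qBinomSeries q t (s ^ (i + 1)))) := by
  have hle : ∀ i : ℕ, s ^ (i + 1) ≤ s := fun i => pow_le_of_le_one hs0 hs1.le (Nat.succ_ne_zero i)
  have hnn : ∀ i : ℕ, 0 ≤ s ^ (i + 1) := fun i => pow_nonneg hs0 _
  have hs : Summable fun i : ℕ => ‖qBinomSeries q t (s ^ (i + 1)) - 1‖ := by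
    refine Summable.of_nonneg_of_le (fun _ => norm_nonneg _) (fun i => ?_)
      (((summable_nat_add_iff 1).2 (summable_geometric_of_lt_one hs0 hs1)).mul_right
        (∑' d : ℕ, qBinomCoeff q t (d + 1) * s ^ d))
    rw [Real.norm_of_nonneg (sub_nonneg.2 (one_le_qBinomSeries hq0 hq1 ht0 ht1 (hnn i)
      ((hle i).trans_lt hs1)))]
    exact qBinomSeries_sub_one_le hq0 hq1 ht0 ht1 (hnn i) (hle i) hs1
  simpa using (multipliable_one_add_of_summable hs).hasProd.tendsto_prod_nat

end QBinomial

lemma ENNReal.tsum_pi_prod_eq_prod_tsum (N : ℕ) (g : ℕ → ℕ → ENNReal) :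
    ∑' d : Fin N → ℕ, ∏ i : Fin N, g i (d i) = ∏ i ∈ range N, ∑' k, g i k := by
  induction N with
  | zero => simp
  | succ N ih =>
    rw [prod_range_succ, ← ih, ← (Fin.snocEquiv fun _ => ℕ).tsum_eq, ENNReal.tsum_prod',
      ENNReal.tsum_comm, ← ENNReal.tsum_mul_right]
    refine tsum_congr fun d => ?_
    rw [← ENNReal.tsum_mul_left]
    refine tsum_congr fun k => ?_
    simp [Fin.snocEquiv, Fin.prod_univ_castSucc]

namespace NatPartition

/-- The partition with at most `N` parts and prescribed differences of consecutive parts. -/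
def ofDiffs (N : ℕ) (d : Fin N → ℕ) : NatPartition where
  part i := ∑ j : Fin N, if i ≤ j then d j else 0
  decr i := sum_le_sum fun j _ => by split_ifs <;> omega
  finite_supp := (Set.finite_Iio N).subset fun i hi => by
    by_contra h
    exact hi (sum_eq_zero fun j _ => if_neg (by have := j.2; simp at h; omega))

variable {N : ℕ}

lemma ofDiffs_part (d : Fin N → ℕ) (i : ℕ) :
    (ofDiffs N d).part i = ∑ j : Fin N, if i ≤ j then d j else 0 := rfl

lemma ofDiffs_part_eq_zero (d : Fin N → ℕ) {i : ℕ} (hi : N ≤ i) : (ofDiffs N d).part i = 0 := by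
  rw [ofDiffs_part]
  exact sum_eq_zero fun j _ => if_neg (by have := j.2; omega)

lemma ofDiffs_diff (d : Fin N → ℕ) (i : Fin N) :
    (ofDiffs N d).part i - (ofDiffs N d).part (i + 1) = d i := by
  have h : (ofDiffs N d).part i = (ofDiffs N d).part (i + 1) + d i := by
    have hd : d i = ∑ j : Fin N, if i = j then d j else 0 := by simp
    rw [hd, ofDiffs_part, ofDiffs_part, ← sum_add_distrib]
    refine sum_congr rfl fun j _ => ?_
    have : i = j ↔ (i : ℕ) = j := Fin.ext_iff
    split_ifs <;> omega
  omega

lemma ofDiffs_injective (N : ℕ) : Function.Injective (ofDiffs N) := fun d e h => by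
  funext i
  rw [← ofDiffs_diff d i, h, ofDiffs_diff]

lemma part_eq_of_diff_eq {l m : NatPartition} (hl : l.part N = 0) (hm : m.part N = 0)
    (h : ∀ i < N, l.part i - l.part (i + 1) = m.part i - m.part (i + 1)) : l = m := by
  have hlm : ∀ i, l.part i = m.part i := fun i => by
    rcases le_total i N with hi | hi
    · induction hi using Nat.decreasingInduction with
      | self => rw [hl, hm]
      | of_succ k hk ih =>
        have := h k hk
        have := l.decr k
        have := m.decr k
        omega
    · have h1 := antitone_nat_of_succ_le l.decr hi
      have h2 := antitone_nat_of_succ_le m.decr hi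
      omega
  cases l; cases m; congr; exact funext hlm

lemma mem_range_ofDiffs {l : NatPartition} (hl : l.part N = 0) : l ∈ Set.range (ofDiffs N) := by
  refine ⟨fun i => l.part i - l.part (i + 1),
    part_eq_of_diff_eq (ofDiffs_part_eq_zero _ le_rfl) hl fun i hi => ?_⟩
  exact ofDiffs_diff (fun i : Fin N => l.part i - l.part (i + 1)) ⟨i, hi⟩

lemma weight_ofDiffs (d : Fin N → ℕ) : (ofDiffs N d).weight = ∑ j : Fin N, (j + 1) * d j := by
  rw [weight, finsum_eq_sum_of_support_subset (s := range N)]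
  · simp only [ofDiffs_part]
    rw [sum_comm]
    refine sum_congr rfl fun j _ => ?_
    rw [← sum_filter, sum_const, smul_eq_mul]
    congr 1
    have : (range N).filter (fun i => i ≤ (j : ℕ)) = range (j + 1) := by
      ext i
      have := j.2
      simp only [mem_filter, mem_range]
      omega
    rw [this, card_range]
  · intro i hi
    by_contra h
    exact hi (ofDiffs_part_eq_zero d (by simpa using h))

lemma finprod_ofDiffs {M : Type*} [CommMonoid M] {a : ℕ → M} (ha : a 0 = 1) (d : Fin N → ℕ) :
    ∏ᶠ i : ℕ, a ((ofDiffs N d).part i - (ofDiffs N d).part (i + 1)) = ∏ i : Fin N, a (d i) := by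
  rw [finprod_eq_prod_of_mulSupport_subset (s := range N)]
  · rw [prod_range]
    simp only [ofDiffs_diff]
  · intro i hi
    by_contra h
    refine hi ?_
    beta_reduce
    rw [ofDiffs_part_eq_zero d (by simpa using h), Nat.zero_sub, ha]

lemma exists_part_eq_zero (l : NatPartition) : ∃ N, ∀ M, N ≤ M → l.part M = 0 := by
  obtain ⟨N, hN⟩ := l.finite_supp.bddAbove
  refine ⟨N + 1, fun M hM => ?_⟩
  by_contra h
  have := hN h
  omega

lemma tsum_eq_iSup (f : NatPartition → ENNReal) :
    ∑' l, f l = ⨆ N, ∑' d : Fin N → ℕ, f (ofDiffs N d) := by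
  refine le_antisymm ?_ (iSup_le fun N =>
    ENNReal.tsum_comp_le_tsum_of_injective (ofDiffs_injective N) f)
  rw [ENNReal.tsum_eq_iSup_sum]
  refine iSup_le fun u => ?_
  choose n hn using exists_part_eq_zero
  refine le_iSup_of_le (u.sup n) ?_
  rw [← tsum_range f (ofDiffs_injective _), ← u.tsum_subtype f]
  exact ENNReal.tsum_mono_subtype f fun l hl => mem_range_ofDiffs (hn l _ (le_sup hl))

end NatPartition

/-- `∑_{λ ∈ Y} F_λ(q,t) s^{|λ|} = ∏_{i=1}^{∞} (t sⁱ; q)_∞ / (sⁱ; q)_∞`,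
where the sum is over all ordinary partitions and, with
`d_i = λ_i - λ_{i+1}`,
`F_λ(q,t) = ∏_{i ≥ 1} ∏_{j=1}^{d_i} (1 - t q^{j-1}) / (1 - q^j)`,
for real `0 ≤ q, t, s < 1`. -/
theorem generating_function_partitions
    (q t s : ℝ) (hq0 : 0 ≤ q) (hq1 : q < 1) (ht0 : 0 ≤ t) (ht1 : t < 1)
    (hs0 : 0 ≤ s) (hs1 : s < 1) :
    ∑' l : NatPartition,
        (∏ᶠ i : ℕ, ∏ j ∈ Finset.range (l.part i - l.part (i + 1)),
            (1 - t * q ^ j) / (1 - q ^ (j + 1))) * s ^ l.weight =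
      ∏' i : ℕ, qPoch (t * s ^ (i + 1)) q / qPoch (s ^ (i + 1)) q := by
  have hnn : ∀ i : ℕ, 0 ≤ s ^ (i + 1) := fun i => pow_nonneg hs0 _
  have hlt : ∀ i : ℕ, s ^ (i + 1) < 1 := fun i => pow_lt_one₀ hs0 hs1 (Nat.succ_ne_zero i)
  have ha : ∀ d, 0 ≤ qBinomCoeff q t d := fun d => (qBinomCoeff_pos hq0 hq1 ht0 ht1 d).le
  have hF : ∀ i : ℕ, 1 ≤ qBinomSeries q t (s ^ (i + 1)) := fun i =>
    one_le_qBinomSeries hq0 hq1 ht0 ht1 (hnn i) (hlt i)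
  simp only [← qBinomSeries_eq_div hq0 hq1 ht0 ht1 (hnn _) (hlt _)]
  have hterm : ∀ (N : ℕ) (d : Fin N → ℕ),
      ENNReal.ofReal ((∏ᶠ i : ℕ, qBinomCoeff q t ((NatPartition.ofDiffs N d).part i -
        (NatPartition.ofDiffs N d).part (i + 1))) * s ^ (NatPartition.ofDiffs N d).weight) =
      ∏ i : Fin N, ENNReal.ofReal (qBinomCoeff q t (d i) * (s ^ ((i : ℕ) + 1)) ^ d i) := by
    intro N d
    rw [NatPartition.finprod_ofDiffs (by simp [qBinomCoeff]), NatPartition.weight_ofDiffs,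
      ← prod_pow_eq_pow_sum, ← prod_mul_distrib, ENNReal.ofReal_prod_of_nonneg]
    · simp only [pow_mul]
    · exact fun i _ => mul_nonneg (ha _) (pow_nonneg hs0 _)
  have hsum : ∑' l : NatPartition, ENNReal.ofReal
      ((∏ᶠ i : ℕ, qBinomCoeff q t (l.part i - l.part (i + 1))) * s ^ l.weight) =
      ENNReal.ofReal (∏' i : ℕ, qBinomSeries q t (s ^ (i + 1))) := by
    rw [NatPartition.tsum_eq_iSup]
    have hN : ∀ N : ℕ, ∑' d : Fin N → ℕ, ENNReal.ofReal ((∏ᶠ i : ℕ, qBinomCoeff q t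
        ((NatPartition.ofDiffs N d).part i - (NatPartition.ofDiffs N d).part (i + 1))) *
          s ^ (NatPartition.ofDiffs N d).weight) =
        ENNReal.ofReal (∏ i ∈ range N, qBinomSeries q t (s ^ (i + 1))) := by
      intro N
      simp only [hterm]
      rw [ENNReal.tsum_pi_prod_eq_prod_tsum N fun i k =>
          ENNReal.ofReal (qBinomCoeff q t k * (s ^ (i + 1)) ^ k),
        ENNReal.ofReal_prod_of_nonneg fun i _ => zero_le_one.trans (hF i)]
      refine prod_congr rfl fun i _ => ?_
      rw [qBinomSeries, ENNReal.ofReal_tsum_of_nonneg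
        (fun k => mul_nonneg (ha k) (pow_nonneg (hnn i) k))
        (summable_qBinomSeries hq0 hq1 (by rw [abs_of_nonneg (hnn i)]; exact hlt i))]
    simp only [hN]
    refine iSup_eq_of_tendsto (monotone_nat_of_le_succ fun N => ENNReal.ofReal_le_ofReal ?_)
      (ENNReal.tendsto_ofReal (tendsto_prod_range_qBinomSeries hq0 hq1 ht0 ht1 hs0 hs1))
    rw [prod_range_succ]
    exact le_mul_of_one_le_right (prod_nonneg fun i _ => zero_le_one.trans (hF i)) (hF N)
  have hl : ∀ l : NatPartition,
      0 ≤ (∏ᶠ i : ℕ, qBinomCoeff q t (l.part i - l.part (i + 1))) * s ^ l.weight := fun l =>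
    mul_nonneg (finprod_nonneg fun i => ha _) (pow_nonneg hs0 _)
  have hP : 0 ≤ ∏' i : ℕ, qBinomSeries q t (s ^ (i + 1)) :=
    ge_of_tendsto' (tendsto_prod_range_qBinomSeries hq0 hq1 ht0 ht1 hs0 hs1) fun N =>
      prod_nonneg fun i _ => zero_le_one.trans (hF i)
  have h := congrArg ENNReal.toReal hsum
  rw [ENNReal.tsum_toReal_eq fun _ => ENNReal.ofReal_ne_top, ENNReal.toReal_ofReal hP] at h
  simp only [ENNReal.toReal_ofReal (hl _)] at h
  exact h
end

section
/- For every positive integer r, ∑_{λ ∈ Y(r)} (1-t)^{k(λ)} s^{|λ|} = ∏_{i=1}^{r} (1 - t s^i) / (1 - s^i), as an identity of formal power series in s with polynomial coefficients in t (equivalently, for real 0 ≤ t, s < 1). -/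
open scoped BigOperators

namespace NatPartition

theorem ext_part {l m : NatPartition} (h : ∀ i, l.part i = m.part i) : l = m := by
  cases l; cases m
  congr
  exact funext h

/-- The partitions with at most `r` nonzero parts. -/
abbrev WithMaxParts (r : ℕ) : Type := {l : NatPartition // ∀ i, r ≤ i → l.part i = 0}

theorem antitone_part (l : NatPartition) : Antitone l.part := antitone_nat_of_succ_le l.decr

theorem weight_eq_sum_range {r : ℕ} (l : WithMaxParts r) :
    l.1.weight = ∑ i ∈ Finset.range r, l.1.part i := by
  refine finsum_eq_sum_of_support_subset _ fun i hi => ?_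
  by_contra h
  exact hi (l.2 i (by simpa using h))

theorem finite_setOf_part_ne_zero (l : NatPartition) :
    {n : ℕ | n ≠ 0 ∧ ∃ i, l.part i = n}.Finite := by
  refine (l.finite_supp.image l.part).subset ?_
  rintro n ⟨hn, i, rfl⟩
  exact ⟨i, hn, rfl⟩

/-- Adding `m` columns of height `r + 1` to a partition with at most `r` parts. -/
def addColumns {r : ℕ} (m : ℕ) (l : WithMaxParts r) : WithMaxParts (r + 1) where
  val :=
    { part := fun i => if i ≤ r then l.1.part i + m else 0
      decr := fun i => by
        have := l.1.decr i
        grind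
      finite_supp := (Set.finite_Iic r).subset fun i hi => by
        by_contra h
        exact hi (if_neg h) }
  property := fun i hi => if_neg (by omega)

/-- Removing all columns of height `r + 1` from a partition with at most `r + 1` parts. -/
def removeColumns {r : ℕ} (l : WithMaxParts (r + 1)) : WithMaxParts r where
  val :=
    { part := fun i => l.1.part i - l.1.part r
      decr := fun i => Nat.sub_le_sub_right (l.1.decr i) _
      finite_supp := l.1.finite_supp.subset fun i hi h => hi (by simp [h]) }
  property := fun _ hi => Nat.sub_eq_zero_of_le (l.1.antitone_part hi)

/-- A partition with at most `r + 1` parts is a partition with at most `r` parts together with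
the number of its columns of height `r + 1`. -/
def columnsEquiv (r : ℕ) : ℕ × WithMaxParts r ≃ WithMaxParts (r + 1) where
  toFun p := addColumns p.1 p.2
  invFun l := (l.1.part r, removeColumns l)
  left_inv p := by
    obtain ⟨m, l⟩ := p
    have h0 := l.2 r le_rfl
    refine Prod.ext (by simp [addColumns, h0]) (Subtype.ext (ext_part fun i => ?_))
    have := l.2 i
    simp only [addColumns, removeColumns]
    grind
  right_inv l := by
    refine Subtype.ext (ext_part fun i => ?_)
    have h1 := l.2 i
    have h2 : i ≤ r → l.1.part r ≤ l.1.part i := fun h => l.1.antitone_part h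
    simp only [addColumns, removeColumns]
    grind

theorem weight_addColumns {r : ℕ} (m : ℕ) (l : WithMaxParts r) :
    (addColumns m l).1.weight = (r + 1) * m + l.1.weight := by
  have hpart : ∀ i ∈ Finset.range (r + 1), (addColumns m l).1.part i = l.1.part i + m :=
    fun i hi => if_pos (Finset.mem_range_succ_iff.mp hi)
  rw [weight_eq_sum_range, weight_eq_sum_range, Finset.sum_congr rfl hpart,
    Finset.sum_add_distrib, Finset.sum_range_succ, l.2 r le_rfl]
  simp [add_comm]

theorem distinctParts_addColumns {r : ℕ} (m : ℕ) (l : WithMaxParts r) :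
    (addColumns m l).1.distinctParts = (if m = 0 then 0 else 1) + l.1.distinctParts := by
  have h0 := l.2 r le_rfl
  split_ifs with hm
  · subst hm
    rw [zero_add]
    congr 1
    refine ext_part fun i => ?_
    have := l.2 i
    simp only [addColumns]
    grind
  · have hset : {n : ℕ | n ≠ 0 ∧ ∃ i, (addColumns m l).1.part i = n} =
        insert m ((· + m) '' {n : ℕ | n ≠ 0 ∧ ∃ i, l.1.part i = n}) := by
      ext n
      simp only [addColumns, Set.mem_ofPred_eq, Set.mem_insert_iff, Set.mem_image]
      constructor
      · rintro ⟨hn, i, rfl⟩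
        by_cases hi : i ≤ r
        · by_cases h : l.1.part i = 0
          · left; simp [hi, h]
          · right; exact ⟨_, ⟨h, i, rfl⟩, by simp [hi]⟩
        · simp [hi] at hn
      · rintro (rfl | ⟨_, ⟨hk, i, rfl⟩, rfl⟩)
        · exact ⟨hm, r, by simp [h0]⟩
        · refine ⟨by omega, i, if_pos ?_⟩
          by_contra h
          exact hk (l.2 i (by omega))
    rw [distinctParts, hset, Set.ncard_insert_of_notMem _ (l.1.finite_setOf_part_ne_zero.image _),
      Set.ncard_image_of_injective _ (add_left_injective m), distinctParts, add_comm]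
    rintro ⟨k, ⟨hk, -⟩, h⟩
    simp only at h
    omega

instance : Unique (WithMaxParts 0) where
  default := ⟨⟨fun _ => 0, fun _ => le_rfl, by simp⟩, fun _ _ => rfl⟩
  uniq l := Subtype.ext (ext_part fun i => l.2 i i.zero_le)

theorem hasSum_ite_pow_mul_pow (t : ℝ) {x : ℝ} (hx0 : 0 ≤ x) (hx1 : x < 1) :
    HasSum (fun m : ℕ => (1 - t) ^ (if m = 0 then 0 else 1) * x ^ m)
      ((1 - t * x) / (1 - x)) := by
  have hx : 1 - x ≠ 0 := by linarith
  have h := ((hasSum_geometric_of_lt_one hx0 hx1).mul_left (1 - t)).add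
    (hasSum_ite_eq (0 : ℕ) t)
  have hval : (1 - t) * (1 - x)⁻¹ + t = (1 - t * x) / (1 - x) := by
    field_simp
    ring
  rw [← hval]
  refine (congrArg (HasSum · _) (funext fun m => ?_)).mp h
  split_ifs with hm <;> simp [hm]

theorem hasSum_distinctParts_weight {t s : ℝ} (ht1 : t ≤ 1) (hs0 : 0 ≤ s) (hs1 : s < 1) (r : ℕ) :
    HasSum (fun l : WithMaxParts r => (1 - t) ^ l.1.distinctParts * s ^ l.1.weight)
      (∏ i ∈ Finset.range r, (1 - t * s ^ (i + 1)) / (1 - s ^ (i + 1))) := by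
  have ht : 0 ≤ 1 - t := by linarith
  induction r with
  | zero =>
    convert hasSum_unique (fun l : WithMaxParts 0 => (1 - t) ^ l.1.distinctParts * s ^ l.1.weight)
    have hd : (default : WithMaxParts 0).1.distinctParts = 0 := by
      rw [distinctParts, Set.ncard_eq_zero (finite_setOf_part_ne_zero _)]
      refine Set.eq_empty_of_forall_notMem ?_
      rintro n ⟨hn, i, rfl⟩
      exact hn rfl
    simp [hd, weight_eq_sum_range]
  | succ r ih =>
    have hm := hasSum_ite_pow_mul_pow t (pow_nonneg hs0 (r + 1))
      (pow_lt_one₀ hs0 hs1 r.succ_ne_zero)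
    rw [Finset.prod_range_succ, mul_comm, ← (columnsEquiv r).hasSum_iff]
    refine (congrArg (HasSum · _) (funext ?_)).mp (hm.mul ih (hm.summable.mul_of_nonneg ih.summable
      (fun m => by positivity) fun l => by positivity))
    rintro ⟨m, l⟩
    simp only [Function.comp_apply, columnsEquiv, Equiv.coe_fn_mk, weight_addColumns,
      distinctParts_addColumns, pow_add, pow_mul]
    ring

end NatPartition

/-- For every positive integer `r`,
`∑_{λ ∈ Y(r)} (1-t)^{k(λ)} s^{|λ|} = ∏_{i=1}^{r} (1 - t sⁱ) / (1 - sⁱ)`,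
where `Y(r)` is the set of partitions with at most `r` nonzero parts and
`k(λ)` is the number of distinct nonzero parts, for real `0 ≤ t, s < 1`. -/
theorem distinct_parts_generating_function_boxed
    (t s : ℝ) (ht0 : 0 ≤ t) (ht1 : t < 1) (hs0 : 0 ≤ s) (hs1 : s < 1)
    (r : ℕ) (hr : 0 < r) :
    ∑' l : {l : NatPartition // ∀ i, r ≤ i → l.part i = 0},
        (1 - t) ^ l.1.distinctParts * s ^ l.1.weight =
      ∏ i ∈ Finset.range r, (1 - t * s ^ (i + 1)) / (1 - s ^ (i + 1)) := by
  exact (NatPartition.hasSum_distinctParts_weight ht1.le hs0 hs1 r).tsum_eq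
end

section
/- ∑_{π ∈ SP} 2^{k(π)} x^{tr(π)} s^{|π|} = ∏_{n=1}^{∞} [ (1 + x s^n) / (1 - x s^n) ]^n, where the sum is over all strict plane partitions, as an identity of formal power series in s and x (equivalently, for real 0 ≤ x, s < 1 with s < 1 strictly). -/
open scoped BigOperators

/-- A plane partition: a filling of a Young diagram (its support) with positive
integers that are weakly decreasing along rows and columns.  Entries outside
the support are recorded as `0`, and rows and columns are indexed from `0`
(so box `(i, j)` is box `(i+1, j+1)` in the 1-indexed convention). -/
structure PlanePartition where
  part : ℕ → ℕ → ℕ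
  row_decr : ∀ i j, part i (j + 1) ≤ part i j
  col_decr : ∀ i j, part (i + 1) j ≤ part i j
  finite_supp : {p : ℕ × ℕ | part p.1 p.2 ≠ 0}.Finite

namespace PlanePartition

/-- The weight `|π|`: the sum of all entries of `π`. -/
noncomputable def weight (π : PlanePartition) : ℕ := ∑ᶠ p : ℕ × ℕ, π.part p.1 p.2

/-- The trace `tr(π)`: the sum of the diagonal entries of `π`. -/
noncomputable def trace (π : PlanePartition) : ℕ := ∑ᶠ i : ℕ, π.part i i

/-- A strict plane partition: all of the diagonal partitions of `π` have
distinct parts, i.e. every diagonal of `π` is strictly decreasing where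
nonzero. -/
def IsStrict (π : PlanePartition) : Prop :=
  ∀ i j, π.part i j ≠ 0 → π.part (i + 1) (j + 1) < π.part i j

end PlanePartition

/-- Two boxes of `ℕ × ℕ` are adjacent when they share an edge. -/
def Adjacent (p q : ℕ × ℕ) : Prop :=
  (p.1 = q.1 ∧ (p.2 + 1 = q.2 ∨ q.2 + 1 = p.2)) ∨
  (p.2 = q.2 ∧ (p.1 + 1 = q.1 ∨ q.1 + 1 = p.1))

/-- One step of connectivity for a filling `g` of boxes by natural numbers:
adjacent boxes carrying the same nonzero entry. -/
def ConnStep (g : ℕ → ℕ → ℕ) (p q : ℕ × ℕ) : Prop :=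
  Adjacent p q ∧ g p.1 p.2 = g q.1 q.2 ∧ g p.1 p.2 ≠ 0

/-- `p` and `q` belong to the same connected component of `g`: both are boxes
of the support and they are joined by a chain of adjacent boxes all filled
with the same number. -/
def SameComponent (g : ℕ → ℕ → ℕ) (p q : ℕ × ℕ) : Prop :=
  g p.1 p.2 ≠ 0 ∧ Relation.ReflTransGen (ConnStep g) p q

/-- The set of connected components of a filling `g`. -/
def components (g : ℕ → ℕ → ℕ) : Set (Set (ℕ × ℕ)) :=
  {C | ∃ p : ℕ × ℕ, g p.1 p.2 ≠ 0 ∧ C = {q | SameComponent g p q}}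

/-- `k(g)`: the number of connected components. -/
noncomputable def numComponents (g : ℕ → ℕ → ℕ) : ℕ := (components g).ncard

/-- The level `h(p)` of a box `p`: the smallest positive `h` such that the box
shifted diagonally by `h` does not belong to the same connected component. -/
noncomputable def level (g : ℕ → ℕ → ℕ) (p : ℕ × ℕ) : ℕ :=
  sInf {h : ℕ | 0 < h ∧ ¬ SameComponent g p (p.1 + h, p.2 + h)}

/-- One step of border connectivity: adjacent boxes with the same nonzero
entry and the same level. -/
def BorderStep (g : ℕ → ℕ → ℕ) (p q : ℕ × ℕ) : Prop :=
  ConnStep g p q ∧ level g p = level g q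

/-- `p` and `q` belong to the same border component. -/
def SameBorder (g : ℕ → ℕ → ℕ) (p q : ℕ × ℕ) : Prop :=
  g p.1 p.2 ≠ 0 ∧ Relation.ReflTransGen (BorderStep g) p q

/-- The set of border components of a filling `g` (each border component is a
maximal connected set of boxes with the same entry and the same level). -/
def borderComponents (g : ℕ → ℕ → ℕ) : Set (Set (ℕ × ℕ)) :=
  {B | ∃ p : ℕ × ℕ, g p.1 p.2 ≠ 0 ∧ B = {q | SameBorder g p q}}

/-- The (common) level of the boxes of a border component `B`. -/
noncomputable def borderLevel (g : ℕ → ℕ → ℕ) (B : Set (ℕ × ℕ)) : ℕ :=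
  sInf {h : ℕ | ∃ p ∈ B, level g p = h}

/-- The polynomial `A_π(t)`: the product over all border components `B` of
`π` of `(1 - t ^ level(B))`; equivalently the product over connected
components `C` of `P_C(t) = ∏_i (1 - t^i)^{n_i}` where `n_i` is the number of
`i`-level border components of `C`. -/
noncomputable def Apoly (t : ℝ) (π : PlanePartition) : ℝ :=
  ∏ᶠ B ∈ borderComponents π.part, (1 - t ^ borderLevel π.part B)

/-- The function `f(n, m)` (for parameters `q`, `t`); the empty product gives
`f(0, m) = 1`. -/
noncomputable def fmac (q t : ℝ) (n m : ℕ) : ℝ :=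
  ∏ i ∈ Finset.range n, (1 - q ^ i * t ^ (m + 1)) / (1 - q ^ (i + 1) * t ^ m)

/-- `F_π(i,j)(q,t)`, associated to the box `(i, j)` of `π`: with
`λ = (π(i,j), π(i+1,j+1), …)`, `μ = (π(i+1,j), π(i+2,j+1), …)` and
`ν = (π(i,j+1), π(i+1,j+2), …)`, this is
`∏_{m ≥ 0} f(λ₁-μ_{m+1},m) f(λ₁-ν_{m+1},m) / (f(λ₁-λ_{m+1},m) f(λ₁-λ_{m+2},m))`
(only finitely many factors differ from `1`). -/
noncomputable def Fbox (q t : ℝ) (π : PlanePartition) (i j : ℕ) : ℝ :=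
  ∏' m : ℕ,
    (fmac q t (π.part i j - π.part (i + 1 + m) (j + m)) m *
        fmac q t (π.part i j - π.part (i + m) (j + 1 + m)) m) /
      (fmac q t (π.part i j - π.part (i + m) (j + m)) m *
        fmac q t (π.part i j - π.part (i + m + 1) (j + m + 1)) m)

/-- `F_π(q,t)`: the product of `F_π(i,j)(q,t)` over all boxes `(i,j)` of the
support of `π`. -/
noncomputable def Fmac (q t : ℝ) (π : PlanePartition) : ℝ :=
  ∏ᶠ p : ℕ × ℕ, if π.part p.1 p.2 ≠ 0 then Fbox q t π p.1 p.2 else 1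

/-- The number of elements of `S` that are at least `v`. A set `S` encodes the strict partition
with parts `u + 1` for `u ∈ S`, so this is the number of parts exceeding `v`. -/
def tailCard (S : Finset ℕ) (v : ℕ) : ℕ := (S.filter (v ≤ ·)).card

/-- The size of the strict partition encoded by `S`. -/
def partSize (S : Finset ℕ) : ℕ := ∑ u ∈ S, (u + 1)

/-- The interlacing relation `hi₁ ≥ lo₁ ≥ hi₂ ≥ lo₂ ≥ ⋯` of strict partitions. -/
def Interlaces (lo hi : Finset ℕ) : Prop :=
  ∀ v, tailCard lo v ≤ tailCard hi v ∧ tailCard hi v ≤ tailCard lo v + 1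

open Classical in
/-- The one-row transfer weight between interlacing strict partitions. -/
noncomputable def transfer (y p r : ℝ) (lo hi : Finset ℕ) : ℝ :=
  if Interlaces lo hi then
    y ^ (partSize hi - partSize lo) * p ^ (hi \ lo).card * r ^ (lo \ hi).card
  else 0

/-- The part of the transfer weight with exactly `h` more parts in `hi` than in `lo`. -/
noncomputable def transferAt (y p r : ℝ) (h : ℕ) (lo hi : Finset ℕ) : ℝ :=
  if tailCard hi 0 = tailCard lo 0 + h then transfer y p r lo hi else 0

/-- Shift `S` up by one and add `0` if `b` holds. -/
def consBit (b : Bool) (S : Finset ℕ) : Finset ℕ :=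
  (if b then {0} else ∅) ∪ S.map (addRightEmbedding 1)

@[simp] lemma zero_mem_consBit {b : Bool} {S : Finset ℕ} : 0 ∈ consBit b S ↔ b = true := by
  cases b <;> simp [consBit]

@[simp] lemma succ_mem_consBit {b : Bool} {S : Finset ℕ} {n : ℕ} :
    n + 1 ∈ consBit b S ↔ n ∈ S := by
  cases b <;> simp [consBit]

/-- Splitting off the element `0` of a finite set of naturals. -/
def consBitEquiv : Bool × Finset ℕ ≃ Finset ℕ where
  toFun x := consBit x.1 x.2
  invFun S := (decide (0 ∈ S), (S.erase 0).image (· - 1))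
  left_inv := by
    rintro ⟨b, S⟩
    refine Prod.ext (by simp) ?_
    ext n
    simp only [Finset.mem_image, Finset.mem_erase]
    constructor
    · rintro ⟨m, ⟨hm, hS⟩, rfl⟩
      obtain ⟨m, rfl⟩ := Nat.exists_eq_succ_of_ne_zero hm
      simpa using hS
    · intro hn
      exact ⟨n + 1, ⟨by simp, by simpa using hn⟩, by simp⟩
  right_inv := by
    intro S
    ext n
    rcases n with _ | n
    · simp
    · simp only [succ_mem_consBit, Finset.mem_image, Finset.mem_erase]
      constructor
      · rintro ⟨m, ⟨hm, hS⟩, rfl⟩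
        rwa [Nat.sub_add_cancel (Nat.pos_of_ne_zero hm)]
      · intro hn
        exact ⟨n + 1, ⟨by simp, hn⟩, by simp⟩

lemma exists_consBit (S : Finset ℕ) : ∃ b T, S = consBit b T :=
  ⟨_, _, (consBitEquiv.apply_symm_apply S).symm⟩

lemma sum_consBit (b : Bool) (S : Finset ℕ) (f : ℕ → ℕ) :
    ∑ u ∈ consBit b S, f u = (if b then f 0 else 0) + ∑ u ∈ S, f (u + 1) := by
  rw [consBit, Finset.sum_union]
  · cases b <;> simp
  · cases b <;> simp

lemma tailCard_eq_sum (S : Finset ℕ) (v : ℕ) :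
    tailCard S v = ∑ u ∈ S, if v ≤ u then 1 else 0 := by
  simp [tailCard]

@[simp] lemma tailCard_consBit_succ (b : Bool) (S : Finset ℕ) (v : ℕ) :
    tailCard (consBit b S) (v + 1) = tailCard S v := by
  rw [tailCard_eq_sum, tailCard_eq_sum, sum_consBit]
  simp

@[simp] lemma tailCard_consBit_zero (b : Bool) (S : Finset ℕ) :
    tailCard (consBit b S) 0 = b.toNat + tailCard S 0 := by
  rw [tailCard_eq_sum, tailCard_eq_sum, sum_consBit]
  cases b <;> simp

lemma partSize_consBit (b : Bool) (S : Finset ℕ) :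
    partSize (consBit b S) = partSize S + b.toNat + tailCard S 0 := by
  rw [partSize, partSize, sum_consBit, tailCard_eq_sum]
  cases b <;> simp [Finset.sum_add_distrib]
  ring

lemma consBit_sdiff (a b : Bool) (S T : Finset ℕ) :
    consBit a S \ consBit b T = consBit (a && !b) (S \ T) := by
  ext n
  rcases n with _ | n <;> simp

lemma card_consBit (b : Bool) (S : Finset ℕ) : (consBit b S).card = b.toNat + S.card := by
  simpa [tailCard] using tailCard_consBit_zero b S

lemma interlaces_consBit {a b : Bool} {lo hi : Finset ℕ} :
    Interlaces (consBit a lo) (consBit b hi) ↔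
      Interlaces lo hi ∧ a.toNat + tailCard lo 0 ≤ b.toNat + tailCard hi 0 ∧
        b.toNat + tailCard hi 0 ≤ a.toNat + tailCard lo 0 + 1 := by
  constructor
  · intro h
    exact ⟨fun v => by simpa using h (v + 1), by simpa using h 0⟩
  · rintro ⟨h, h0⟩ (_ | v)
    · simpa using h0
    · simpa using h v

lemma consBit_subset_range {b : Bool} {S : Finset ℕ} {n : ℕ} :
    consBit b S ⊆ Finset.range (n + 1) → S ⊆ Finset.range n := by
  intro h u hu
  have := h (succ_mem_consBit (b := b) |>.2 hu)
  simpa using this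

lemma tailCard_lt_iff {S : Finset ℕ} {v : ℕ} : tailCard S (v + 1) < tailCard S v ↔ v ∈ S := by
  have h : tailCard S v = tailCard S (v + 1) + if v ∈ S then 1 else 0 := by
    simp only [tailCard_eq_sum]
    rw [← Finset.sum_ite_eq S v (fun _ => 1), ← Finset.sum_add_distrib]
    refine Finset.sum_congr rfl fun u _ => ?_
    split_ifs <;> omega
  split_ifs at h with hv <;> simp [hv] <;> omega

lemma tailCard_le_succ (S : Finset ℕ) (v : ℕ) : tailCard S v ≤ tailCard S (v + 1) + 1 := by
  induction v generalizing S with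
  | zero =>
    obtain ⟨b, T, rfl⟩ := exists_consBit S
    have : b.toNat ≤ 1 := Bool.toNat_le b
    simp
    omega
  | succ v ih =>
    obtain ⟨b, T, rfl⟩ := exists_consBit S
    simpa using ih T

lemma Interlaces.partSize_le {lo hi : Finset ℕ} (h : Interlaces lo hi) :
    partSize lo ≤ partSize hi := by
  obtain ⟨n, hn⟩ : ∃ n, lo ∪ hi ⊆ Finset.range n := Finset.exists_nat_subset_range _
  induction n generalizing lo hi with
  | zero =>
    have : lo ∪ hi = ∅ := by simpa using hn
    obtain ⟨rfl, rfl⟩ := Finset.union_eq_empty.1 this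
    rfl
  | succ n ih =>
    obtain ⟨a, lo, rfl⟩ := exists_consBit lo
    obtain ⟨b, hi, rfl⟩ := exists_consBit hi
    obtain ⟨h, h1, -⟩ := interlaces_consBit.1 h
    rw [Finset.union_subset_iff] at hn
    have := ih h (Finset.union_subset (consBit_subset_range hn.1) (consBit_subset_range hn.2))
    rw [partSize_consBit, partSize_consBit]
    omega

lemma transfer_eq_add (y p r : ℝ) (lo hi : Finset ℕ) :
    transfer y p r lo hi = transferAt y p r 0 lo hi + transferAt y p r 1 lo hi := by
  unfold transferAt
  by_cases h : Interlaces lo hi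
  · have := h 0
    split_ifs <;> first | omega | simp
  · simp [transfer, h]

lemma transferAt_consBit (y p r : ℝ) {a b : Bool} {h h' : ℕ} (hh : h ≤ 1)
    (hab : h + a.toNat = h' + b.toNat) (lo hi : Finset ℕ) :
    transferAt y p r h (consBit a lo) (consBit b hi) =
      y ^ h * p ^ (b && !a).toNat * r ^ (a && !b).toNat * transferAt y p r h' lo hi := by
  unfold transferAt
  simp only [tailCard_consBit_zero]
  by_cases hc : tailCard hi 0 = tailCard lo 0 + h'
  · rw [if_pos (by omega), if_pos hc]
    unfold transfer
    by_cases hI : Interlaces lo hi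
    · rw [if_pos hI, if_pos (interlaces_consBit.2 ⟨hI, by omega, by omega⟩)]
      rw [consBit_sdiff, consBit_sdiff, card_consBit, card_consBit, pow_add, pow_add,
        partSize_consBit, partSize_consBit]
      have := hI.partSize_le
      have e : partSize hi + b.toNat + tailCard hi 0 - (partSize lo + a.toNat + tailCard lo 0)
        = h + (partSize hi - partSize lo) := by omega
      rw [e, pow_add]
      ring
    · rw [if_neg hI, if_neg (fun h => hI (interlaces_consBit.1 h).1), mul_zero]
  · rw [if_neg (by omega), if_neg hc, mul_zero]

lemma transferAt_zero_consBit_false_true (y p r : ℝ) (lo hi : Finset ℕ) :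
    transferAt y p r 0 (consBit false lo) (consBit true hi) = 0 := by
  unfold transferAt transfer
  split_ifs with h1 h2
  · have := ((interlaces_consBit.1 h2).1 0).1
    simp at h1
    omega
  all_goals rfl

lemma transferAt_one_consBit_true_false (y p r : ℝ) (lo hi : Finset ℕ) :
    transferAt y p r 1 (consBit true lo) (consBit false hi) = 0 := by
  unfold transferAt transfer
  split_ifs with h1 h2
  · have := ((interlaces_consBit.1 h2).1 0).2
    simp at h1
    omega
  all_goals rfl

lemma hasSum_consBit {f : Finset ℕ → ℝ} {u v : ℝ}
    (h0 : HasSum (fun S => f (consBit false S)) u)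
    (h1 : HasSum (fun S => f (consBit true S)) v) : HasSum f (u + v) := by
  rw [← consBitEquiv.hasSum_iff, ← (Equiv.boolProdEquivSum _).symm.hasSum_iff]
  exact h0.sum h1

lemma transferAt_empty_left {y p r : ℝ} {h : ℕ} {hi : Finset ℕ}
    (hne : transferAt y p r h ∅ hi ≠ 0) : hi.card = h ∧ h ≤ 1 := by
  unfold transferAt transfer at hne
  split_ifs at hne with h1 h2
  · have := h2 0
    simp [tailCard] at h1 this
    omega
  all_goals exact absurd rfl hne

lemma interlaces_empty_right {lo : Finset ℕ} : Interlaces lo ∅ ↔ lo = ∅ := by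
  constructor
  · intro h
    simpa [tailCard] using (h 0).1
  · rintro rfl v
    simp

lemma transferAt_empty_right {y p r : ℝ} {h : ℕ} {lo : Finset ℕ}
    (hne : transferAt y p r h lo ∅ ≠ 0) : lo = ∅ ∧ h = 0 := by
  unfold transferAt transfer at hne
  split_ifs at hne with h1 h2
  · rw [interlaces_empty_right] at h2
    subst h2
    simpa [tailCard] using h1.symm
  all_goals exact absurd rfl hne

lemma transferAt_empty_empty (y p r : ℝ) : transferAt y p r 0 ∅ ∅ = 1 := by
  simp [transferAt, transfer, Interlaces]

lemma interlaces_empty_singleton (u : ℕ) : Interlaces ∅ {u} := by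
  intro v
  simp only [tailCard, Finset.filter_empty, Finset.card_empty, zero_le, true_and, zero_add]
  exact Finset.card_filter_le _ _

lemma transferAt_empty_singleton (y p r : ℝ) (u : ℕ) :
    transferAt y p r 1 ∅ {u} = y ^ (u + 1) * p := by
  simp [transferAt, transfer, interlaces_empty_singleton, tailCard, partSize]

lemma hasSum_transferAt_empty (z w : ℝ) (h k : ℕ) (hh : (h, k) ≠ (1, 1)) :
    HasSum (fun S => transferAt z 1 2 h ∅ S * transferAt w 2 1 k ∅ S)
      (if (h, k) = (0, 0) then 1 else 0) := by
  convert hasSum_single (f := fun S => transferAt z 1 2 h ∅ S * transferAt w 2 1 k ∅ S)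
    ∅ ?_ using 1
  · split_ifs with h0
    · obtain ⟨rfl, rfl⟩ := Prod.mk.injEq .. ▸ h0
      simp [transferAt_empty_empty]
    · by_contra hne
      have hne := mul_ne_zero_iff.1 (Ne.symm hne)
      have h1 := transferAt_empty_right hne.1
      have h2 := transferAt_empty_right hne.2
      exact h0 (by rw [h1.2, h2.2])
  · intro S hS
    by_contra hne
    have hne := mul_ne_zero_iff.1 hne
    have h1 := transferAt_empty_left hne.1
    have h2 := transferAt_empty_left hne.2
    have : S.card ≠ 0 := by simpa using hS
    exact hh (by rw [Prod.mk.injEq]; omega)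

lemma hasSum_transferAt_empty_one (z w : ℝ) (hzw : |z * w| < 1) :
    HasSum (fun S => transferAt z 1 2 1 ∅ S * transferAt w 2 1 1 ∅ S)
      (2 * (z * w) / (1 - z * w)) := by
  have hinj : Function.Injective (fun u : ℕ => ({u} : Finset ℕ)) := Finset.singleton_injective
  rw [← hinj.hasSum_iff]
  · have := (hasSum_geometric_of_abs_lt_one hzw).mul_left (2 * (z * w))
    rw [← div_eq_mul_inv] at this
    refine this.congr_fun fun u => ?_
    simp only [Function.comp, transferAt_empty_singleton]
    ring
  · intro S hS
    by_contra hne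
    obtain ⟨u, rfl⟩ := Finset.card_eq_one.1 (transferAt_empty_left (mul_ne_zero_iff.1 hne).1).1
    exact hS ⟨u, rfl⟩

/-- The exchange relation between one raising row and one lowering row, refined by the number of
parts added; the coefficients are those of the free-fermionic `R`-matrix. -/
lemma exists_hasSum_exchange (z w : ℝ) (hzw : |z * w| < 1) (α β : Finset ℕ) :
    ∃ g00 g11 g01 g10 : ℝ,
      (HasSum (fun μ => transferAt z 1 2 0 μ β * transferAt w 2 1 0 μ α) g00 ∧
       HasSum (fun μ => transferAt z 1 2 1 μ β * transferAt w 2 1 1 μ α) g11 ∧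
       HasSum (fun μ => transferAt z 1 2 0 μ β * transferAt w 2 1 1 μ α) g01 ∧
       HasSum (fun μ => transferAt z 1 2 1 μ β * transferAt w 2 1 0 μ α) g10) ∧
      HasSum (fun S => transferAt z 1 2 0 α S * transferAt w 2 1 0 β S)
        (g00 + 2 / (1 - z * w) * g11) ∧
      HasSum (fun S => transferAt z 1 2 1 α S * transferAt w 2 1 1 β S)
        (2 * (z * w) / (1 - z * w) * g00 - g11) ∧
      HasSum (fun S => transferAt z 1 2 0 α S * transferAt w 2 1 1 β S)
        ((1 + z * w) / (1 - z * w) * g01) ∧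
      HasSum (fun S => transferAt z 1 2 1 α S * transferAt w 2 1 0 β S)
        ((1 + z * w) / (1 - z * w) * g10) := by
  have hne : 1 - z * w ≠ 0 := by
    have := (abs_lt.1 hzw).2
    linarith
  obtain ⟨n, hn⟩ : ∃ n, α ∪ β ⊆ Finset.range n := Finset.exists_nat_subset_range _
  induction n generalizing α β with
  | zero =>
    have : α ∪ β = ∅ := by simpa using hn
    obtain ⟨rfl, rfl⟩ := Finset.union_eq_empty.1 this
    have hz : ∀ h k : ℕ, (h, k) ≠ (0, 0) →
        HasSum (fun μ => transferAt z 1 2 h μ ∅ * transferAt w 2 1 k μ ∅) 0 := by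
      intro h k hhk
      convert hasSum_zero with μ
      by_contra hne
      have hne := mul_ne_zero_iff.1 hne
      exact hhk (by rw [(transferAt_empty_right hne.1).2, (transferAt_empty_right hne.2).2])
    refine ⟨1, 0, 0, 0, ⟨?_, hz _ _ (by simp), hz _ _ (by simp), hz _ _ (by simp)⟩, ?_, ?_, ?_, ?_⟩
    · convert hasSum_single (f := fun μ => transferAt z 1 2 0 μ ∅ * transferAt w 2 1 0 μ ∅) ∅ ?_
        using 1
      · simp [transferAt_empty_empty]
      · intro S hS
        by_contra hne
        exact hS (transferAt_empty_right (mul_ne_zero_iff.1 hne).1).1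
    · simpa using hasSum_transferAt_empty z w 0 0 (by simp)
    · simpa using hasSum_transferAt_empty_one z w hzw
    · simpa using hasSum_transferAt_empty z w 0 1 (by simp)
    · simpa using hasSum_transferAt_empty z w 1 0 (by simp)
  | succ n ih =>
    obtain ⟨a, α, rfl⟩ := exists_consBit α
    obtain ⟨b, β, rfl⟩ := exists_consBit β
    rw [Finset.union_subset_iff] at hn
    obtain ⟨g00, g11, g01, g10, ⟨G00, G11, G01, G10⟩, F00, F11, F01, F10⟩ := ih α β
      (Finset.union_subset (consBit_subset_range hn.1) (consBit_subset_range hn.2))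
    have ff0 : ∀ (y p r : ℝ) lo hi, transferAt y p r 0 (consBit false lo) (consBit false hi)
        = transferAt y p r 0 lo hi := fun y p r lo hi => by
      simpa using transferAt_consBit y p r (a := false) (b := false) (h' := 0) zero_le_one rfl lo hi
    have tt0 : ∀ (y p r : ℝ) lo hi, transferAt y p r 0 (consBit true lo) (consBit true hi)
        = transferAt y p r 0 lo hi := fun y p r lo hi => by
      simpa using transferAt_consBit y p r (a := true) (b := true) (h' := 0) zero_le_one rfl lo hi
    have ff1 : ∀ (y p r : ℝ) lo hi, transferAt y p r 1 (consBit false lo) (consBit false hi)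
        = y * transferAt y p r 1 lo hi := fun y p r lo hi => by
      simpa using transferAt_consBit y p r (a := false) (b := false) (h' := 1) le_rfl rfl lo hi
    have tt1 : ∀ (y p r : ℝ) lo hi, transferAt y p r 1 (consBit true lo) (consBit true hi)
        = y * transferAt y p r 1 lo hi := fun y p r lo hi => by
      simpa using transferAt_consBit y p r (a := true) (b := true) (h' := 1) le_rfl rfl lo hi
    have tf0 : ∀ (y p r : ℝ) lo hi, transferAt y p r 0 (consBit true lo) (consBit false hi)
        = r * transferAt y p r 1 lo hi := fun y p r lo hi => by
      simpa using transferAt_consBit y p r (a := true) (b := false) (h' := 1) zero_le_one rfl lo hi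
    have ft1 : ∀ (y p r : ℝ) lo hi, transferAt y p r 1 (consBit false lo) (consBit true hi)
        = y * p * transferAt y p r 0 lo hi := fun y p r lo hi => by
      simpa using transferAt_consBit y p r (a := false) (b := true) (h' := 0) le_rfl rfl lo hi
    have ft0 := transferAt_zero_consBit_false_true
    have tf1 := transferAt_one_consBit_true_false
    have comb : ∀ {f : Finset ℕ → ℝ} {f0 f1 : Finset ℕ → ℝ} {u v c d t : ℝ}, HasSum f0 u →
        HasSum f1 v → (∀ S, f (consBit false S) = c * f0 S) →
        (∀ S, f (consBit true S) = d * f1 S) → c * u + d * v = t → HasSum f t := by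
      rintro f f0 f1 u v c d t h0 h1 e0 e1 rfl
      refine hasSum_consBit ?_ ?_
      · simpa only [e0] using h0.mul_left c
      · simpa only [e1] using h1.mul_left d
    cases a <;> cases b
    · refine ⟨g00 + 2 * g11, z * w * g11, w * g01, z * g10,
      ⟨comb G00 G11 (c := 1) (d := 2) ?_ ?_ ?_,
        comb G11 G00 (c := z * w) (d := 0) ?_ ?_ ?_,
        comb G01 G00 (c := w) (d := 0) ?_ ?_ ?_,
        comb G10 G00 (c := z) (d := 0) ?_ ?_ ?_⟩,
      comb F00 F00 (c := 1) (d := 0) ?_ ?_ ?_,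
      comb F11 F00 (c := z * w) (d := z * (w * 2)) ?_ ?_ ?_,
      comb F01 F00 (c := w) (d := 0) ?_ ?_ ?_,
      comb F10 F00 (c := z) (d := 0) ?_ ?_ ?_⟩
      all_goals first
        | intro S; simp only [ff0, ff1, tt0, tt1, tf0, tf1, ft0, ft1]; ring1
        | ring1
        | field_simp; ring1
    · refine ⟨g01, z * w * g01, 0, z * g00 + z * g11,
      ⟨comb G00 G01 (c := 0) (d := 1) ?_ ?_ ?_,
        comb G01 G00 (c := z * w) (d := 0) ?_ ?_ ?_,
        comb G00 G00 (c := 0) (d := 0) ?_ ?_ ?_,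
        comb G00 G11 (c := z) (d := z) ?_ ?_ ?_⟩,
      comb F01 F00 (c := 1) (d := 0) ?_ ?_ ?_,
      comb F00 F01 (c := 0) (d := z * w) ?_ ?_ ?_,
      comb F00 F00 (c := 0) (d := 0) ?_ ?_ ?_,
      comb F11 F00 (c := z) (d := z) ?_ ?_ ?_⟩
      all_goals first
        | intro S; simp only [ff0, ff1, tt0, tt1, tf0, tf1, ft0, ft1]; ring1
        | ring1
        | field_simp; ring1
    · refine ⟨2 * g10, z * (w * 2) * g10, (w * 2) * g00 + 2 * w * g11, 0,
      ⟨comb G00 G10 (c := 0) (d := 2) ?_ ?_ ?_,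
        comb G10 G00 (c := z * (w * 2)) (d := 0) ?_ ?_ ?_,
        comb G00 G11 (c := (w * 2)) (d := 2 * w) ?_ ?_ ?_,
        comb G00 G00 (c := 0) (d := 0) ?_ ?_ ?_⟩,
      comb F10 F00 (c := 2) (d := 0) ?_ ?_ ?_,
      comb F00 F10 (c := 0) (d := z * (w * 2)) ?_ ?_ ?_,
      comb F11 F00 (c := 2 * w) (d := (w * 2)) ?_ ?_ ?_,
      comb F00 F00 (c := 0) (d := 0) ?_ ?_ ?_⟩
      all_goals first
        | intro S; simp only [ff0, ff1, tt0, tt1, tf0, tf1, ft0, ft1]; ring1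
        | ring1
        | field_simp; ring1
        | linear_combination (2 * w * g11 - 2 * w * g00) * mul_inv_cancel₀ hne
    · refine ⟨g00, z * (w * 2) * g00 + z * w * g11, w * g01, z * g10,
      ⟨comb G00 G00 (c := 0) (d := 1) ?_ ?_ ?_,
        comb G00 G11 (c := z * (w * 2)) (d := z * w) ?_ ?_ ?_,
        comb G00 G01 (c := 0) (d := w) ?_ ?_ ?_,
        comb G00 G10 (c := 0) (d := z) ?_ ?_ ?_⟩,
      comb F11 F00 (c := 2) (d := 1) ?_ ?_ ?_,
      comb F00 F11 (c := 0) (d := z * w) ?_ ?_ ?_,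
      comb F00 F01 (c := 0) (d := w) ?_ ?_ ?_,
      comb F00 F10 (c := 0) (d := z) ?_ ?_ ?_⟩
      all_goals first
        | intro S; simp only [ff0, ff1, tt0, tt1, tf0, tf1, ft0, ft1]; ring1
        | ring1
        | field_simp; ring1

open scoped ENNReal

/-- The transfer weight as an extended nonnegative real. -/
noncomputable def rowWeight (y p r : ℝ) (lo hi : Finset ℕ) : ℝ≥0∞ :=
  ENNReal.ofReal (transfer y p r lo hi)

lemma transfer_nonneg {y p r : ℝ} (hy : 0 ≤ y) (hp : 0 ≤ p) (hr : 0 ≤ r) (lo hi : Finset ℕ) :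
    0 ≤ transfer y p r lo hi := by
  unfold transfer
  split_ifs <;> positivity

/-- The one-variable factor `(1 + a) / (1 - a)` of the shifted MacMahon product. -/
noncomputable def macFactor (a : ℝ) : ℝ≥0∞ := ENNReal.ofReal ((1 + a) / (1 - a))

theorem tsum_rowWeight_exchange {z w : ℝ} (hz : 0 ≤ z) (hw : 0 ≤ w) (hzw : z * w < 1)
    (α β : Finset ℕ) :
    ∑' S, rowWeight w 2 1 β S * rowWeight z 1 2 α S =
      macFactor (z * w) * ∑' μ, rowWeight w 2 1 μ α * rowWeight z 1 2 μ β := by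
  have hpos : 0 ≤ z * w := mul_nonneg hz hw
  obtain ⟨g00, g11, g01, g10, ⟨G00, G11, G01, G10⟩, F00, F11, F01, F10⟩ :=
    exists_hasSum_exchange z w (by rwa [abs_of_nonneg hpos]) α β
  have hne : 1 - z * w ≠ 0 := by linarith
  have G : HasSum (fun μ => transfer w 2 1 μ α * transfer z 1 2 μ β) (g00 + g11 + g01 + g10) := by
    refine (((G00.add G11).add G01).add G10).congr_fun fun μ => ?_
    rw [transfer_eq_add, transfer_eq_add]
    ring
  have F : HasSum (fun S => transfer w 2 1 β S * transfer z 1 2 α S)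
      ((1 + z * w) / (1 - z * w) * (g00 + g11 + g01 + g10)) := by
    convert ((F00.add F11).add F01).add F10 using 1
    · funext S
      rw [transfer_eq_add, transfer_eq_add]
      ring
    · field_simp
      ring
  have key : ∀ {f : Finset ℕ → Finset ℕ → ℝ} {g : Finset ℕ → Finset ℕ → ℝ} {t : ℝ}
      {γ δ : Finset ℕ}, (∀ S, 0 ≤ f γ S) → (∀ S, 0 ≤ g δ S) →
      HasSum (fun S => f γ S * g δ S) t →
      ∑' S, ENNReal.ofReal (f γ S) * ENNReal.ofReal (g δ S) = ENNReal.ofReal t := by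
    intro f g t γ δ hf hg h
    rw [← h.tsum_eq, ENNReal.ofReal_tsum_of_nonneg (fun S => mul_nonneg (hf S) (hg S)) h.summable]
    exact tsum_congr fun S => (ENNReal.ofReal_mul (hf S)).symm
  have hT : ∀ (y p r : ℝ) (_ : 0 ≤ y) (_ : 0 ≤ p) (_ : 0 ≤ r) (lo hi : Finset ℕ),
    0 ≤ transfer y p r lo hi := fun y p r hy hp hr => transfer_nonneg hy hp hr
  unfold rowWeight macFactor
  rw [key (f := fun γ S => transfer w 2 1 γ S) (g := fun γ S => transfer z 1 2 γ S)
      (fun S => hT _ _ _ hw two_pos.le zero_le_one _ _)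
      (fun S => hT _ _ _ hz zero_le_one two_pos.le _ _) F,
    key (f := fun γ S => transfer w 2 1 S γ) (g := fun γ S => transfer z 1 2 S γ)
      (fun S => hT _ _ _ hw two_pos.le zero_le_one _ _)
      (fun S => hT _ _ _ hz zero_le_one two_pos.le _ _) G,
    ENNReal.ofReal_mul (div_nonneg (by linarith) (by linarith))]

/-- Prepend a term to a sequence. -/
def seqCons {A : Type*} : A × (ℕ → A) ≃ (ℕ → A) where
  toFun x n := Nat.casesOn n x.1 x.2
  invFun f := (f 0, fun n => f (n + 1))
  left_inv _ := rfl
  right_inv f := by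
    funext n
    cases n <;> rfl

@[simp] lemma seqCons_zero {A : Type*} (a : A) (f : ℕ → A) : seqCons (a, f) 0 = a := rfl

lemma tsum_seqCons {A : Type*} (F : (ℕ → A) → ℝ≥0∞) :
    ∑' f, F f = ∑' f, ∑' a, F (seqCons (a, f)) := by
  rw [← seqCons.tsum_eq, ENNReal.tsum_prod', ENNReal.tsum_comm]

/-- The weight of a sequence of strict partitions, each interlacing with the previous one, which
is empty from index `m` on. -/
noncomputable def chainWeight (p r s : ℝ) : ℕ → ℝ → (ℕ → Finset ℕ) → ℝ≥0∞
  | 0, _, f => open Classical in if f = fun _ => ∅ then 1 else 0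
  | m + 1, y, f =>
    rowWeight y p r (f 1) (f 0) * chainWeight p r s m (y * s) (fun i => f (i + 1))

lemma chainWeight_seqCons (p r s : ℝ) (m : ℕ) (y : ℝ) (S : Finset ℕ) (f : ℕ → Finset ℕ) :
    chainWeight p r s (m + 1) y (seqCons (S, f)) =
      rowWeight y p r (f 0) S * chainWeight p r s m (y * s) f := rfl

lemma tsum_chainWeight_zero (p r s y : ℝ) (F : (ℕ → Finset ℕ) → ℝ≥0∞) :
    ∑' f, F f * chainWeight p r s 0 y f = F (fun _ => ∅) := by
  rw [tsum_eq_single (fun _ => ∅)]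
  · simp [chainWeight]
  · intro f hf
    simp [chainWeight, hf]

/-- The generating function of chains is an eigenfunction of a lowering row. -/
lemma tsum_rowWeight_chainWeight {s : ℝ} (hs0 : 0 ≤ s) (hs1 : s ≤ 1) (n : ℕ) {z w : ℝ}
    (hz : 0 ≤ z) (hw : 0 ≤ w) (hzw : z * w < 1) (β : Finset ℕ) :
    ∑' g, rowWeight z 2 1 β (g 0) * chainWeight 1 2 s n w g =
      (∏ j ∈ Finset.range n, macFactor (z * w * s ^ j)) *
        ∑' g, (open Classical in if g 0 = β then 1 else 0) * chainWeight 1 2 s n w g := by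
  induction n generalizing w β with
  | zero =>
    rw [tsum_chainWeight_zero, tsum_chainWeight_zero]
    by_cases h : β = ∅
    · subst h
      simp [rowWeight, transfer, interlaces_empty_right]
    · simp [rowWeight, transfer, interlaces_empty_right, h, Ne.symm h]
  | succ n ih =>
    have hws : 0 ≤ w * s := mul_nonneg hw hs0
    have hzws : z * (w * s) < 1 :=
      lt_of_le_of_lt (mul_le_mul_of_nonneg_left (mul_le_of_le_one_right hw hs1) hz) hzw
    calc ∑' g, rowWeight z 2 1 β (g 0) * chainWeight 1 2 s (n + 1) w g
        = ∑' g, (∑' S, rowWeight z 2 1 β S * rowWeight w 1 2 (g 0) S) *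
            chainWeight 1 2 s n (w * s) g := by
          rw [tsum_seqCons]
          refine tsum_congr fun g => ?_
          rw [← ENNReal.tsum_mul_right]
          refine tsum_congr fun S => ?_
          rw [chainWeight_seqCons, seqCons_zero, mul_assoc]
      _ = macFactor (z * w) * ∑' μ, rowWeight w 1 2 μ β *
            ∑' g, rowWeight z 2 1 μ (g 0) * chainWeight 1 2 s n (w * s) g := by
          simp_rw [tsum_rowWeight_exchange hw hz (mul_comm z w ▸ hzw), mul_comm w z,
            ← ENNReal.tsum_mul_left, ← ENNReal.tsum_mul_right]
          rw [ENNReal.tsum_comm]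
          refine tsum_congr fun μ => tsum_congr fun g => ?_
          ring
      _ = (∏ j ∈ Finset.range (n + 1), macFactor (z * w * s ^ j)) *
            ∑' μ, rowWeight w 1 2 μ β *
              ∑' g, (open Classical in if g 0 = μ then 1 else 0) *
                chainWeight 1 2 s n (w * s) g := by
          simp_rw [ih hws hzws]
          rw [Finset.prod_range_succ', pow_zero, mul_one, mul_comm (∏ k ∈ _, _), mul_assoc]
          congr 1
          rw [← ENNReal.tsum_mul_left]
          refine tsum_congr fun μ => ?_
          rw [mul_left_comm]
          congr 1
          exact Finset.prod_congr rfl fun j _ => by rw [pow_succ', mul_assoc, mul_assoc, mul_assoc]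
      _ = _ := by
          congr 1
          rw [tsum_seqCons]
          simp_rw [← ENNReal.tsum_mul_left]
          rw [ENNReal.tsum_comm]
          refine tsum_congr fun g => ?_
          rw [tsum_eq_single (g 0) (fun μ hμ => by simp [hμ.symm]),
            tsum_eq_single β (fun S hS => by simp [hS])]
          simp [chainWeight_seqCons]

/-- The Cauchy identity for chains of strict partitions. -/
lemma tsum_chainWeight_mul {s : ℝ} (hs0 : 0 ≤ s) (hs1 : s ≤ 1) (m n : ℕ) {z w : ℝ}
    (hz : 0 ≤ z) (hw : 0 ≤ w) (hzw : z * w < 1) :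
    ∑' f, (∑' g, (open Classical in if g 0 = f 0 then 1 else 0) * chainWeight 1 2 s n w g) *
        chainWeight 2 1 s m z f =
      ∏ i ∈ Finset.range m, ∏ j ∈ Finset.range n, macFactor (z * w * s ^ (i + j)) := by
  induction m generalizing z with
  | zero =>
    rw [tsum_chainWeight_zero, Finset.range_zero, Finset.prod_empty]
    clear hzw
    induction n generalizing w with
    | zero => rw [tsum_chainWeight_zero]; simp
    | succ n ih =>
      refine Eq.trans ?_ (ih (mul_nonneg hw hs0))
      rw [tsum_seqCons]
      refine tsum_congr fun g => ?_
      rw [tsum_eq_single ∅ (fun S hS => by simp [hS])]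
      simp only [chainWeight_seqCons]
      by_cases h : g 0 = ∅
      · simp [h, rowWeight, transfer, Interlaces]
      · simp [h, rowWeight, transfer, interlaces_empty_right]
  | succ m ih =>
    have hzs : 0 ≤ z * s := mul_nonneg hz hs0
    have hzws : z * s * w < 1 :=
      lt_of_le_of_lt (mul_le_mul_of_nonneg_right (mul_le_of_le_one_right hz hs1) hw) hzw
    rw [Finset.prod_range_succ', tsum_seqCons]
    have e : ∀ i j, z * w * s ^ (i + 1 + j) = z * s * w * s ^ (i + j) := fun i j => by ring
    simp_rw [e, zero_add]
    rw [← ih hzs hzws, ← ENNReal.tsum_mul_right]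
    refine tsum_congr fun f => ?_
    rw [mul_right_comm, mul_comm _ (∏ j ∈ _, _),
      ← tsum_rowWeight_chainWeight hs0 hs1 n hz hw hzw, ← ENNReal.tsum_mul_right]
    simp_rw [chainWeight_seqCons, seqCons_zero, ← ENNReal.tsum_mul_right]
    rw [ENNReal.tsum_comm]
    refine tsum_congr fun g => ?_
    rw [tsum_eq_single (g 0) (fun S hS => by simp [hS.symm])]
    simp only [if_true]
    ring

/-- A sequence of strict partitions, each interlacing with the previous one, which is empty from
index `N` on. -/
def IsInterlacingChain (N : ℕ) (f : ℕ → Finset ℕ) : Prop :=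
  (∀ i, Interlaces (f (i + 1)) (f i)) ∧ ∀ i, N ≤ i → f i = ∅

lemma isInterlacingChain_zero {f : ℕ → Finset ℕ} : IsInterlacingChain 0 f ↔ f = fun _ => ∅ := by
  refine ⟨fun h => funext fun i => h.2 i (Nat.zero_le i), ?_⟩
  rintro rfl
  exact ⟨fun _ => interlaces_empty_right.2 rfl, fun _ _ => rfl⟩

lemma isInterlacingChain_succ {N : ℕ} {f : ℕ → Finset ℕ} :
    IsInterlacingChain (N + 1) f ↔ Interlaces (f 1) (f 0) ∧ IsInterlacingChain N (fun i => f (i + 1)) := by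
  constructor
  · exact fun h => ⟨h.1 0, fun i => h.1 (i + 1), fun i hi => h.2 (i + 1) (by omega)⟩
  · rintro ⟨h0, h1, h2⟩
    refine ⟨fun i => ?_, fun i hi => ?_⟩
    · cases i with
      | zero => exact h0
      | succ i => exact h1 i
    · obtain ⟨i, rfl⟩ : ∃ j, i = j + 1 := ⟨i - 1, by omega⟩
      exact h2 i (by omega)

lemma chainWeight_of_not_isInterlacingChain {p r s : ℝ} {N : ℕ} {y : ℝ} {f : ℕ → Finset ℕ}
    (h : ¬ IsInterlacingChain N f) : chainWeight p r s N y f = 0 := by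
  induction N generalizing y f with
  | zero => exact if_neg (mt isInterlacingChain_zero.2 h)
  | succ N ih =>
    rw [isInterlacingChain_succ, not_and_or] at h
    rw [chainWeight]
    rcases h with h | h
    · rw [rowWeight, transfer, if_neg h, ENNReal.ofReal_zero, zero_mul]
    · rw [ih h, mul_zero]

lemma chainWeight_of_isInterlacingChain {p r s : ℝ} (hp : 0 ≤ p) (hr : 0 ≤ r) (hs : 0 ≤ s) {N : ℕ} {y : ℝ}
    (hy : 0 ≤ y) {f : ℕ → Finset ℕ} (h : IsInterlacingChain N f) :
    chainWeight p r s N y f = ENNReal.ofReal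
      (y ^ partSize (f 0) * s ^ (∑ i ∈ Finset.range N, partSize (f (i + 1))) *
        p ^ (∑ i ∈ Finset.range N, (f i \ f (i + 1)).card) *
        r ^ (∑ i ∈ Finset.range N, (f (i + 1) \ f i).card)) := by
  induction N generalizing y f with
  | zero =>
    rw [isInterlacingChain_zero] at h
    subst h
    simp [chainWeight, partSize]
  | succ N ih =>
    obtain ⟨h0, h1⟩ := isInterlacingChain_succ.1 h
    rw [chainWeight, ih (mul_nonneg hy hs) h1, rowWeight,
      ← ENNReal.ofReal_mul (transfer_nonneg hy hp hr _ _), transfer, if_pos h0]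
    obtain ⟨m, hm⟩ := Nat.exists_eq_add_of_le h0.partSize_le
    simp only [Finset.sum_range_succ', zero_add, hm, Nat.add_sub_cancel_left]
    congr 1
    ring

/-- A sequence of natural numbers which is strictly decreasing until it reaches zero. -/
def IsStrictSeq (d : ℕ → ℕ) : Prop := ∀ k, d (k + 1) ≤ d k - 1

/-- The set of the nonzero values of a sequence, shifted down by one. -/
noncomputable def seqSet (d : ℕ → ℕ) : Finset ℕ :=
  open Classical in (Finset.range (d 0)).filter fun u => ∃ k, d k = u + 1

lemma IsStrictSeq.antitone {d : ℕ → ℕ} (hd : IsStrictSeq d) : Antitone d :=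
  antitone_nat_of_succ_le fun k => (hd k).trans (Nat.sub_le _ _)

lemma IsStrictSeq.lt_of_lt {d : ℕ → ℕ} (hd : IsStrictSeq d) {k m : ℕ} (hkm : k < m)
    (hk : d k ≠ 0) : d m < d k := by
  have h1 := hd.antitone (Nat.succ_le_of_lt hkm)
  have h2 := hd k
  simp only [Nat.succ_eq_add_one] at h1
  omega

lemma mem_seqSet {d : ℕ → ℕ} (hd : IsStrictSeq d) {u : ℕ} : u ∈ seqSet d ↔ ∃ k, d k = u + 1 := by
  simp only [seqSet, Finset.mem_filter, Finset.mem_range, and_iff_right_iff_imp]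
  rintro ⟨k, hk⟩
  have := hd.antitone (Nat.zero_le k)
  omega

lemma IsStrictSeq.add_le {d : ℕ → ℕ} (hd : IsStrictSeq d) {k : ℕ} (hk : d k ≠ 0) :
    d k + k ≤ d 0 := by
  induction k with
  | zero => rfl
  | succ k ih =>
    have := hd k
    have := ih (by omega)
    omega

lemma sum_seqSet {d : ℕ → ℕ} (hd : IsStrictSeq d) {M : ℕ} (hM : d M = 0) (F : ℕ → ℕ) :
    ∑ u ∈ seqSet d, F u = ∑ k ∈ Finset.range M, if d k ≠ 0 then F (d k - 1) else 0 := by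
  have himg : seqSet d = ((Finset.range M).filter (d · ≠ 0)).image (d · - 1) := by
    ext u
    simp only [mem_seqSet hd, Finset.mem_image, Finset.mem_filter, Finset.mem_range]
    constructor
    · rintro ⟨k, hk⟩
      refine ⟨k, ⟨?_, by omega⟩, by omega⟩
      by_contra h
      have := hd.antitone (not_lt.1 h)
      omega
    · rintro ⟨k, hk, rfl⟩
      exact ⟨k, by omega⟩
  rw [himg, Finset.sum_image, Finset.sum_filter]
  intro a ha b hb hab
  simp only [Finset.coe_filter, Set.mem_ofPred_eq] at ha hb
  rcases lt_trichotomy a b with h | h | h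
  · have := hd.lt_of_lt h ha.2
    dsimp only at hab
    omega
  · exact h
  · have := hd.lt_of_lt h hb.2
    dsimp only at hab
    omega

lemma lt_tailCard_seqSet {d : ℕ → ℕ} (hd : IsStrictSeq d) {k v : ℕ} :
    k < tailCard (seqSet d) v ↔ v < d k := by
  classical
  have hM : d (d 0 + 1) = 0 := by
    by_contra h
    have := hd.add_le h
    omega
  have hex : ∃ k, d k ≤ v := ⟨_, hM.le.trans (Nat.zero_le v)⟩
  have hlt : ∀ m, m < Nat.find hex ↔ v < d m := fun m => by
    rw [Nat.lt_find_iff]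
    exact ⟨fun h => not_le.1 (h m le_rfl), fun h j hj =>
      not_le.2 (h.trans_le (hd.antitone hj))⟩
  have hcard : tailCard (seqSet d) v = Nat.find hex := by
    have hle : Nat.find hex ≤ d 0 + 1 := Nat.find_min' _ (hM.le.trans (Nat.zero_le v))
    rw [tailCard, Finset.card_filter, sum_seqSet hd hM, ← Finset.card_range (Nat.find hex),
      Finset.card_eq_sum_ones, ← Finset.sum_subset (Finset.range_subset_range.2 hle)]
    · refine Finset.sum_congr rfl fun m hm => ?_
      have := (hlt m).1 (Finset.mem_range.1 hm)
      rw [if_pos (by omega), if_pos (by omega)]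
    · intro m _ hm
      have := mt (hlt m).2 (mt Finset.mem_range.2 hm)
      split_ifs <;> omega
  rw [hcard, hlt]

lemma exists_tailCard_le (S : Finset ℕ) (k : ℕ) : ∃ v, tailCard S v ≤ k := by
  refine ⟨S.sup id + 1, ?_⟩
  rw [tailCard, Finset.filter_false_of_mem]
  · simp
  · intro u hu
    have := Finset.le_sup (f := id) hu
    simp only [id] at this
    omega

/-- The decreasing sequence of the parts of a strict partition, continued by zeros. -/
def partSeq (S : Finset ℕ) (k : ℕ) : ℕ := Nat.find (exists_tailCard_le S k)

lemma tailCard_antitone (S : Finset ℕ) : Antitone (tailCard S) := fun _ _ h =>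
  Finset.card_le_card (Finset.monotone_filter_right _ fun _ _ hu => h.trans hu)

lemma lt_partSeq {S : Finset ℕ} {k v : ℕ} : v < partSeq S k ↔ k < tailCard S v := by
  rw [partSeq, Nat.lt_find_iff]
  exact ⟨fun h => not_le.1 (h v le_rfl), fun h j hj =>
    not_le.2 (h.trans_le (tailCard_antitone S hj))⟩

lemma isStrictSeq_partSeq (S : Finset ℕ) : IsStrictSeq (partSeq S) := by
  intro k
  by_contra! h
  obtain ⟨v, hv⟩ : ∃ v, partSeq S (k + 1) = v + 1 := ⟨partSeq S (k + 1) - 1, by omega⟩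
  have h1 := lt_partSeq.1 (show v < partSeq S (k + 1) by omega)
  have h2 := tailCard_le_succ S v
  have h3 := lt_partSeq.2 (show k < tailCard S (v + 1) by omega)
  omega

lemma seqSet_partSeq (S : Finset ℕ) : seqSet (partSeq S) = S := by
  have h : tailCard (seqSet (partSeq S)) = tailCard S := funext fun v =>
    eq_of_forall_lt_iff fun k => by rw [lt_tailCard_seqSet (isStrictSeq_partSeq S), lt_partSeq]
  ext u
  rw [← tailCard_lt_iff, h, tailCard_lt_iff]

lemma seqSet_injective {d e : ℕ → ℕ} (hd : IsStrictSeq d) (he : IsStrictSeq e)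
    (h : seqSet d = seqSet e) : d = e := funext fun k =>
  eq_of_forall_lt_iff fun v => by rw [← lt_tailCard_seqSet hd, h, lt_tailCard_seqSet he]

lemma interlaces_seqSet {d e : ℕ → ℕ} (hd : IsStrictSeq d) (he : IsStrictSeq e) :
    Interlaces (seqSet e) (seqSet d) ↔ ∀ k, e k ≤ d k ∧ d (k + 1) ≤ e k := by
  constructor
  · refine fun h k => ⟨le_of_forall_lt fun v hv => ?_, le_of_forall_lt fun v hv => ?_⟩
    · exact (lt_tailCard_seqSet hd).1 (((lt_tailCard_seqSet he).2 hv).trans_le (h v).1)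
    · rw [← lt_tailCard_seqSet hd] at hv
      rw [← lt_tailCard_seqSet he]
      have := (h v).2
      omega
  · refine fun h v => ⟨le_of_forall_lt fun k hk => ?_, ?_⟩
    · rw [lt_tailCard_seqSet he] at hk
      exact (lt_tailCard_seqSet hd).2 (hk.trans_le (h k).1)
    · by_contra! hlt
      rw [lt_tailCard_seqSet hd] at hlt
      exact lt_irrefl _ ((lt_tailCard_seqSet he).2 (hlt.trans_le (h _).2))

lemma seqSet_eq_empty {d : ℕ → ℕ} (hd : IsStrictSeq d) : seqSet d = ∅ ↔ d 0 = 0 := by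
  constructor
  · intro h
    by_contra h0
    have : d 0 - 1 ∈ seqSet d := (mem_seqSet hd).2 ⟨0, by omega⟩
    simp [h] at this
  · intro h
    simp [seqSet, h]

namespace PlanePartition

/-- The diagonals of `π` weakly above the main one, as sets of parts shifted down by one. -/
noncomputable def upperDiag (π : PlanePartition) (c : ℕ) : Finset ℕ :=
  seqSet fun k => π.part k (k + c)

/-- The diagonals of `π` weakly below the main one, as sets of parts shifted down by one. -/
noncomputable def lowerDiag (π : PlanePartition) (c : ℕ) : Finset ℕ :=
  seqSet fun k => π.part (k + c) k

lemma part_mono (π : PlanePartition) {i i' j j' : ℕ} (hi : i ≤ i') (hj : j ≤ j') :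
    π.part i' j' ≤ π.part i j :=
  (antitone_nat_of_succ_le (f := fun i => π.part i j') (fun _ => π.col_decr _ _) hi).trans
    (antitone_nat_of_succ_le (f := fun j => π.part i j) (fun _ => π.row_decr _ _) hj)

/-- The transpose of a plane partition. -/
def transpose (π : PlanePartition) : PlanePartition where
  part i j := π.part j i
  row_decr i j := π.col_decr j i
  col_decr i j := π.row_decr j i
  finite_supp := π.finite_supp.preimage Prod.swap_injective.injOn

namespace IsStrict

variable {π : PlanePartition}

lemma isStrictSeq (h : π.IsStrict) (i j : ℕ) : IsStrictSeq fun k => π.part (k + i) (k + j) := by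
  intro k
  have h1 := h (k + i) (k + j)
  have h2 := π.part_mono (Nat.le_succ (k + i)) (Nat.le_succ (k + j))
  simp only [add_right_comm k 1, Nat.succ_eq_add_one] at h2 ⊢
  omega

lemma transpose (h : π.IsStrict) : π.transpose.IsStrict := fun i j => h j i

lemma isStrictSeq_upper (h : π.IsStrict) (c : ℕ) : IsStrictSeq fun k => π.part k (k + c) :=
  h.isStrictSeq 0 c

lemma isStrictSeq_lower (h : π.IsStrict) (c : ℕ) : IsStrictSeq fun k => π.part (k + c) k :=
  h.isStrictSeq c 0

lemma isInterlacingChain_upperDiag (h : π.IsStrict) {N : ℕ} :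
    IsInterlacingChain N π.upperDiag ↔ π.part 0 N = 0 := by
  constructor
  · intro hN
    simpa using (seqSet_eq_empty (h.isStrictSeq_upper N)).1 (hN.2 N le_rfl)
  · refine fun hN => ⟨fun c => ?_, fun c hc => ?_⟩
    · refine (interlaces_seqSet (h.isStrictSeq_upper c) (h.isStrictSeq_upper (c + 1))).2
        fun k => ⟨π.row_decr _ _, ?_⟩
      rw [add_right_comm]
      exact π.col_decr _ _
    · refine (seqSet_eq_empty (h.isStrictSeq_upper c)).2 (Nat.le_zero.1 ?_)
      rw [zero_add]
      exact (π.part_mono le_rfl hc).trans hN.le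

lemma isInterlacingChain_lowerDiag (h : π.IsStrict) {N : ℕ} :
    IsInterlacingChain N π.lowerDiag ↔ π.part N 0 = 0 :=
  h.transpose.isInterlacingChain_upperDiag

end IsStrict

lemma diag_injective {π ρ : PlanePartition} (hπ : π.IsStrict) (hρ : ρ.IsStrict)
    (hu : π.upperDiag = ρ.upperDiag) (hl : π.lowerDiag = ρ.lowerDiag) : π = ρ := by
  have h : π.part = ρ.part := by
    funext i j
    rcases le_total i j with hij | hij
    · have := congrFun (seqSet_injective (hπ.isStrictSeq_upper (j - i))
        (hρ.isStrictSeq_upper (j - i)) (congrFun hu _)) i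
      simpa only [Nat.add_sub_cancel' hij] using this
    · have := congrFun (seqSet_injective (hπ.isStrictSeq_lower (i - j))
        (hρ.isStrictSeq_lower (i - j)) (congrFun hl _)) j
      simpa only [Nat.add_sub_cancel' hij] using this
  cases π
  cases ρ
  congr

lemma exists_diag_eq {M N : ℕ} {f g : ℕ → Finset ℕ} (hf : IsInterlacingChain M f)
    (hg : IsInterlacingChain N g) (h0 : g 0 = f 0) :
    ∃ π : PlanePartition, π.IsStrict ∧ π.upperDiag = f ∧ π.lowerDiag = g := by
  let P : ℕ → ℕ → ℕ := fun i j => if i ≤ j then partSeq (f (j - i)) i else partSeq (g (i - j)) j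
  have hPf : ∀ k c, P k (k + c) = partSeq (f c) k := fun k c => by simp [P]
  have hPg : ∀ k c, P (k + c) k = partSeq (g c) k := fun k c => by
    rcases c with _ | c
    · simp [P, h0]
    · simp [P]
  have inter : ∀ {f : ℕ → Finset ℕ} {N : ℕ}, IsInterlacingChain N f → ∀ c k,
      partSeq (f (c + 1)) k ≤ partSeq (f c) k ∧ partSeq (f c) (k + 1) ≤ partSeq (f (c + 1)) k := by
    intro f N hf c
    rw [← interlaces_seqSet (isStrictSeq_partSeq _) (isStrictSeq_partSeq _), seqSet_partSeq,
      seqSet_partSeq]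
    exact hf.1 c
  have dich : ∀ i j, (∃ c, j = i + c) ∨ ∃ c, i = j + (c + 1) := fun i j => by
    rcases le_or_gt i j with h | h
    · exact Or.inl ⟨j - i, by omega⟩
    · exact Or.inr ⟨i - j - 1, by omega⟩
  have hrow : ∀ i j, P i (j + 1) ≤ P i j := by
    intro i j
    rcases dich i j with ⟨c, rfl⟩ | ⟨c, rfl⟩
    · rw [add_assoc, hPf, hPf]
      exact (inter hf c i).1
    · rw [hPg, add_comm c, ← add_assoc, hPg, add_comm 1 c]
      exact (inter hg c j).2
  have hcol : ∀ i j, P (i + 1) j ≤ P i j := by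
    intro i j
    rcases dich i j with ⟨c, rfl⟩ | ⟨c, rfl⟩
    · rw [hPf]
      rcases c with _ | c
      · rw [add_zero, hPg, ← h0]
        exact (inter hg 0 i).1
      · rw [add_comm c, ← add_assoc, hPf, add_comm 1 c]
        exact (inter hf c i).2
    · rw [add_assoc, hPg, hPg]
      exact (inter hg (c + 1) j).1
  have hmono : ∀ {i i' j j' : ℕ}, i ≤ i' → j ≤ j' → P i' j' ≤ P i j := fun hi hj =>
    (antitone_nat_of_succ_le (f := fun i => P i _) (fun _ => hcol _ _) hi).trans
      (antitone_nat_of_succ_le (f := fun j => P _ j) (fun _ => hrow _ _) hj)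
  have hempty : ∀ k, partSeq ∅ k = 0 := fun k => by
    by_contra h
    have := lt_partSeq.1 (Nat.pos_of_ne_zero h)
    simp [tailCard] at this
  have hM : P 0 M = 0 := by
    have := hPf 0 M
    rwa [zero_add, hf.2 M le_rfl, hempty] at this
  have hN : P N 0 = 0 := by
    have := hPg 0 N
    rwa [zero_add, hg.2 N le_rfl, hempty] at this
  let π : PlanePartition := ⟨P, hrow, hcol, by
    refine ((Finset.range N ×ˢ Finset.range M).finite_toSet).subset ?_
    rintro ⟨i, j⟩ hij
    simp only [Finset.coe_product, Finset.coe_range, Set.mem_prod, Set.mem_Iio]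
    constructor
    · by_contra h
      exact hij (Nat.le_zero.1 ((hmono (not_lt.1 h) (Nat.zero_le j)).trans hN.le))
    · by_contra h
      exact hij (Nat.le_zero.1 ((hmono (Nat.zero_le i) (not_lt.1 h)).trans hM.le))⟩
  refine ⟨π, ?_, ?_, ?_⟩
  · intro i j hij
    change P i j ≠ 0 at hij
    change P (i + 1) (j + 1) < P i j
    rcases dich i j with ⟨c, rfl⟩ | ⟨c, rfl⟩
    · rw [add_right_comm, hPf, hPf] at *
      exact (isStrictSeq_partSeq _).lt_of_lt i.lt_succ_self hij
    · rw [add_right_comm, hPg, hPg] at *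
      exact (isStrictSeq_partSeq _).lt_of_lt j.lt_succ_self hij
  · funext c
    change seqSet (fun k => P k (k + c)) = _
    simp_rw [hPf]
    exact seqSet_partSeq _
  · funext c
    change seqSet (fun k => P (k + c) k) = _
    simp_rw [hPg]
    exact seqSet_partSeq _

end PlanePartition

lemma finsum_eq_sum_diagonals {M : ℕ} {w : ℕ × ℕ → ℕ}
    (hw : ∀ p, w p ≠ 0 → p.1 < M ∧ p.2 < M) :
    ∑ᶠ p, w p = ∑ c ∈ Finset.range M, ∑ k ∈ Finset.range M, w (k, k + c) +
      ∑ c ∈ Finset.range M, ∑ k ∈ Finset.range M, w (k + (c + 1), k) := by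
  classical
  let S := Finset.range M ×ˢ Finset.range M
  let up : ℕ × ℕ → ℕ × ℕ := fun q => (q.2, q.2 + q.1)
  let lo : ℕ × ℕ → ℕ × ℕ := fun q => (q.2 + (q.1 + 1), q.2)
  have hup : Set.InjOn up S := by
    rintro ⟨a, b⟩ _ ⟨c, d⟩ _ h
    simp only [up, Prod.mk.injEq] at h ⊢
    omega
  have hlo : Set.InjOn lo S := by
    rintro ⟨a, b⟩ _ ⟨c, d⟩ _ h
    simp only [lo, Prod.mk.injEq] at h ⊢
    omega
  have hdisj : Disjoint (S.image up) (S.image lo) := by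
    simp only [Finset.disjoint_left, Finset.mem_image, not_exists, not_and]
    rintro _ ⟨q, _, rfl⟩ q' _ h
    simp only [up, lo, Prod.mk.injEq] at h
    omega
  rw [finsum_eq_sum_of_support_subset (s := S.image up ∪ S.image lo), Finset.sum_union hdisj,
    Finset.sum_image hup, Finset.sum_image hlo, Finset.sum_product, Finset.sum_product]
  rintro ⟨i, j⟩ hp
  obtain ⟨hi, hj⟩ := hw _ hp
  simp only [Finset.coe_union, Finset.coe_image, Set.mem_union, Set.mem_image, up, lo, S,
    Finset.coe_product, Finset.coe_range, Set.mem_prod, Set.mem_Iio, Prod.mk.injEq] at *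
  rcases le_or_gt i j with h | h
  · exact Or.inl ⟨(j - i, i), by omega⟩
  · exact Or.inr ⟨(i - j - 1, j), by omega⟩

/-- One step from a box to the box above it or to its right, with the same nonzero entry. -/
def NEStep (g : ℕ → ℕ → ℕ) (p q : ℕ × ℕ) : Prop :=
  g p.1 p.2 ≠ 0 ∧ g p.1 p.2 = g q.1 q.2 ∧
    (q.1 + 1 = p.1 ∧ q.2 = p.2 ∨ q.1 = p.1 ∧ q.2 = p.2 + 1)

/-- A box of the support whose neighbours above and to the right have different entries. -/
def IsEnd (g : ℕ → ℕ → ℕ) (p : ℕ × ℕ) : Prop := g p.1 p.2 ≠ 0 ∧ ∀ q, ¬ NEStep g p q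

lemma connStep_iff {g : ℕ → ℕ → ℕ} {p q : ℕ × ℕ} :
    ConnStep g p q ↔ NEStep g p q ∨ NEStep g q p := by
  unfold ConnStep NEStep Adjacent
  constructor
  · rintro ⟨h, h1, h2⟩
    have h3 : g q.1 q.2 ≠ 0 := h1 ▸ h2
    rcases h with ⟨h, h' | h'⟩ | ⟨h, h' | h'⟩
    · exact Or.inl ⟨h2, h1, Or.inr ⟨h.symm, h'.symm⟩⟩
    · exact Or.inr ⟨h3, h1.symm, Or.inr ⟨h, h'.symm⟩⟩
    · exact Or.inr ⟨h3, h1.symm, Or.inl ⟨h', h⟩⟩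
    · exact Or.inl ⟨h2, h1, Or.inl ⟨h', h.symm⟩⟩
  · rintro (⟨h1, h2, h⟩ | ⟨h1, h2, h⟩)
    · exact ⟨by omega, h2, h1⟩
    · exact ⟨by omega, h2.symm, h2 ▸ h1⟩

lemma sameComponent_symm {g : ℕ → ℕ → ℕ} {p q : ℕ × ℕ} (h : SameComponent g p q) :
    SameComponent g q p := by
  have hsymm : Std.Symm (ConnStep g) := ⟨fun a b hab => by
    rw [connStep_iff] at hab ⊢
    exact hab.symm⟩
  refine ⟨?_, Relation.ReflTransGen.stdSymm.symm _ _ h.2⟩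
  obtain ⟨h0, h⟩ := h
  induction h with
  | refl => exact h0
  | tail _ h ih => exact h.2.1 ▸ ih

namespace PlanePartition

variable {π : PlanePartition}

lemma IsStrict.neStep_unique (h : π.IsStrict) {p q q' : ℕ × ℕ} (hq : NEStep π.part p q)
    (hq' : NEStep π.part p q') : q = q' := by
  obtain ⟨i, j⟩ := p
  obtain ⟨a, b⟩ := q
  obtain ⟨c, d⟩ := q'
  obtain ⟨h0, h1, h2⟩ := hq
  obtain ⟨-, h3, h4⟩ := hq'
  dsimp only at *
  rcases h2 with ⟨rfl, rfl⟩ | ⟨rfl, rfl⟩ <;> rcases h4 with ⟨h4, rfl⟩ | ⟨h4, rfl⟩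
  · rw [Nat.succ_injective h4]
  · subst h4
    have := h a b (h1 ▸ h0)
    omega
  · subst h4
    have := h c d (h3 ▸ h0)
    omega
  · rw [h4]

lemma exists_part_eq_zero (π : PlanePartition) :
    ∃ M, ∀ N, M ≤ N → π.part 0 N = 0 ∧ π.part N 0 = 0 := by
  obtain ⟨B, hB⟩ := (π.finite_supp.image fun p => p.1 + p.2).bddAbove
  refine ⟨B + 1, fun N hN => ⟨?_, ?_⟩⟩
  · by_contra h
    have := hB ⟨(0, N), h, rfl⟩
    simp only at this
    omega
  · by_contra h
    have := hB ⟨(N, 0), h, rfl⟩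
    simp only at this
    omega

lemma lt_of_part_ne_zero {M : ℕ} (h1 : π.part 0 M = 0) (h2 : π.part M 0 = 0) {i j : ℕ}
    (h : π.part i j ≠ 0) : i < M ∧ j < M := by
  constructor <;> by_contra hlt
  · exact h (Nat.le_zero.1 ((π.part_mono (not_lt.1 hlt) (Nat.zero_le j)).trans h2.le))
  · exact h (Nat.le_zero.1 ((π.part_mono (Nat.zero_le i) (not_lt.1 hlt)).trans h1.le))

lemma exists_isEnd (π : PlanePartition) {p : ℕ × ℕ} (hp : π.part p.1 p.2 ≠ 0) :
    ∃ e, IsEnd π.part e ∧ Relation.ReflTransGen (NEStep π.part) p e := by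
  obtain ⟨M, hM⟩ := π.exists_part_eq_zero
  obtain ⟨h1, h2⟩ := hM M le_rfl
  induction hn : p.1 + (M - p.2) using Nat.strong_induction_on generalizing p with
  | _ n ih =>
    by_cases hend : IsEnd π.part p
    · exact ⟨p, hend, .refl⟩
    · simp only [IsEnd, not_and, not_forall, not_not] at hend
      obtain ⟨q, hq⟩ := hend hp
      have hq0 : π.part q.1 q.2 ≠ 0 := hq.2.1 ▸ hp
      have hlt := lt_of_part_ne_zero h1 h2 hp
      have hlt' := lt_of_part_ne_zero h1 h2 hq0
      obtain ⟨e, he, hqe⟩ := ih _ (by have := hq.2.2; omega) hq0 rfl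
      exact ⟨e, he, .head hq hqe⟩

lemma IsStrict.reflTransGen_of_sameComponent (h : π.IsStrict) {e q : ℕ × ℕ}
    (he : IsEnd π.part e) (hq : SameComponent π.part e q) :
    Relation.ReflTransGen (NEStep π.part) q e := by
  obtain ⟨-, hq⟩ := hq
  induction hq with
  | refl => exact .refl
  | @tail q q' _ hstep ih =>
    rcases connStep_iff.1 hstep with hs | hs
    · rcases Relation.ReflTransGen.cases_head ih with rfl | ⟨r, hr, hre⟩
      · exact absurd hs (he.2 _)
      · rwa [h.neStep_unique hs hr]
    · exact .head hs ih

lemma IsStrict.numComponents_eq (h : π.IsStrict) :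
    numComponents π.part = {p | IsEnd π.part p}.ncard := by
  have himg : components π.part =
      (fun e => {q | SameComponent π.part e q}) '' {p | IsEnd π.part p} := by
    ext C
    constructor
    · rintro ⟨p, hp, rfl⟩
      obtain ⟨e, he, hpe⟩ := π.exists_isEnd hp
      have hsame : SameComponent π.part p e :=
        ⟨hp, Relation.ReflTransGen.mono (fun _ _ hab => connStep_iff.2 (Or.inl hab)) _ _ hpe⟩
      have hsame' := sameComponent_symm hsame
      refine ⟨e, he, ?_⟩
      ext q
      exact ⟨fun hq => ⟨hp, hsame.2.trans hq.2⟩, fun hq => ⟨he.1, hsame'.2.trans hq.2⟩⟩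
    · rintro ⟨e, he, rfl⟩
      exact ⟨e, he.1, rfl⟩
  rw [numComponents, himg, Set.InjOn.ncard_image]
  intro e he e' he' hee
  have hmem : SameComponent π.part e e' := by
    have : e' ∈ {q | SameComponent π.part e' q} := ⟨he'.1, .refl⟩
    simp only at hee
    rwa [← hee] at this
  rcases (h.reflTransGen_of_sameComponent he hmem).cases_head with rfl | ⟨r, hr, -⟩
  · rfl
  · exact absurd hr (he'.2 r)

end PlanePartition

lemma IsStrictSeq.eq_or_eq_of_eq {d e : ℕ → ℕ} (hd : IsStrictSeq d) (he : IsStrictSeq e)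
    (hed : ∀ k, e k ≤ d k ∧ d (k + 1) ≤ e k) {k m : ℕ} (hk : d k ≠ 0) (h : e m = d k) :
    m = k ∨ m + 1 = k := by
  by_contra! hne
  rcases lt_or_gt_of_ne hne.1 with hlt | hlt
  · have h1 : m + 1 < k := by omega
    obtain ⟨j, rfl⟩ : ∃ j, k = j + 1 := ⟨k - 1, by omega⟩
    have h2 := he.lt_of_lt (show m < j by omega) (h ▸ hk)
    have h3 := (hed j).2
    omega
  · have h2 := hd.lt_of_lt hlt hk
    have h3 := (hed m).1
    omega

namespace PlanePartition

variable {π : PlanePartition}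

lemma IsStrict.isEnd_upper (h : π.IsStrict) {k c : ℕ} (h0 : π.part k (k + c) ≠ 0) :
    IsEnd π.part (k, k + c) ↔ π.part k (k + c) - 1 ∉ π.upperDiag (c + 1) := by
  simp only [IsEnd, NEStep, upperDiag, mem_seqSet (h.isStrictSeq_upper _), Nat.sub_add_cancel
    (Nat.pos_of_ne_zero h0), ne_eq, h0, not_false_eq_true, true_and, not_exists, not_and]
  constructor
  · intro hend m hm
    rcases (h.isStrictSeq_upper c).eq_or_eq_of_eq (h.isStrictSeq_upper (c + 1))
      (fun k => ⟨π.row_decr _ _, by rw [add_right_comm]; exact π.col_decr _ _⟩) h0 hm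
      with rfl | rfl
    · exact hend (m, m + (c + 1)) hm.symm (Or.inr ⟨rfl, rfl⟩)
    · exact hend (m, m + (c + 1)) hm.symm (Or.inl ⟨rfl, by dsimp only; omega⟩)
  · rintro hend ⟨i, j⟩ hij (⟨h1, h2⟩ | ⟨h1, h2⟩) <;> dsimp only at hij h1 h2
    · obtain rfl : j = i + (c + 1) := by omega
      exact hend i hij.symm
    · obtain rfl : j = i + (c + 1) := by omega
      exact hend i hij.symm

lemma IsStrict.isEnd_lower (h : π.IsStrict) {k c : ℕ} (h0 : π.part (k + (c + 1)) k ≠ 0) :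
    IsEnd π.part (k + (c + 1), k) ↔ π.part (k + (c + 1)) k - 1 ∉ π.lowerDiag c := by
  simp only [IsEnd, NEStep, lowerDiag, mem_seqSet (h.isStrictSeq_lower _), Nat.sub_add_cancel
    (Nat.pos_of_ne_zero h0), ne_eq, h0, not_false_eq_true, true_and, not_exists, not_and]
  constructor
  · intro hend m hm
    rcases (h.isStrictSeq_lower c).eq_or_eq_of_eq (h.isStrictSeq_lower (c + 1))
      (fun k => ⟨π.col_decr _ _, by rw [add_right_comm]; exact π.row_decr _ _⟩)
      (hm.trans_ne h0) hm.symm with rfl | rfl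
    · exact hend (k + c, k) hm.symm (Or.inl ⟨rfl, rfl⟩)
    · exact hend (k + 1 + c, k + 1) hm.symm (Or.inr ⟨by dsimp only; omega, rfl⟩)
  · rintro hend ⟨i, j⟩ hij (⟨h1, h2⟩ | ⟨h1, h2⟩) <;> dsimp only at hij h1 h2
    · obtain rfl : i = j + c := by omega
      exact hend j hij.symm
    · obtain rfl : i = j + c := by omega
      exact hend j hij.symm

lemma IsStrict.sum_upperDiag (h : π.IsStrict) {N : ℕ} (h1 : π.part 0 N = 0) (c : ℕ)
    (F : ℕ → ℕ) : ∑ u ∈ π.upperDiag c, F u =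
      ∑ k ∈ Finset.range N, if π.part k (k + c) ≠ 0 then F (π.part k (k + c) - 1) else 0 :=
  sum_seqSet (h.isStrictSeq_upper c)
    (Nat.le_zero.1 ((π.part_mono (Nat.zero_le N) (Nat.le_add_right N c)).trans h1.le)) F

lemma IsStrict.sum_lowerDiag (h : π.IsStrict) {N : ℕ} (h2 : π.part N 0 = 0) (c : ℕ)
    (F : ℕ → ℕ) : ∑ u ∈ π.lowerDiag c, F u =
      ∑ k ∈ Finset.range N, if π.part (k + c) k ≠ 0 then F (π.part (k + c) k - 1) else 0 :=
  h.transpose.sum_upperDiag h2 c F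

lemma IsStrict.trace_eq (h : π.IsStrict) {N : ℕ} (h1 : π.part 0 N = 0) :
    π.trace = partSize (π.upperDiag 0) := by
  rw [partSize, h.sum_upperDiag h1, trace, finsum_eq_sum_of_support_subset (s := Finset.range N)]
  · refine Finset.sum_congr rfl fun k _ => ?_
    rw [add_zero]
    split_ifs <;> omega
  · intro i hi
    rw [Finset.coe_range, Set.mem_Iio]
    by_contra hlt
    exact hi (Nat.le_zero.1 ((π.part_mono (Nat.zero_le i) (not_lt.1 hlt)).trans h1.le))

lemma IsStrict.weight_eq (h : π.IsStrict) {N : ℕ} (h1 : π.part 0 N = 0) (h2 : π.part N 0 = 0) :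
    π.weight = ∑ c ∈ Finset.range N, partSize (π.upperDiag c) +
      ∑ c ∈ Finset.range N, partSize (π.lowerDiag (c + 1)) := by
  rw [weight, finsum_eq_sum_diagonals fun p => lt_of_part_ne_zero h1 h2]
  congr 1 <;> refine Finset.sum_congr rfl fun c _ => ?_
  · rw [partSize, h.sum_upperDiag h1]
    refine Finset.sum_congr rfl fun k _ => ?_
    split_ifs <;> dsimp only <;> omega
  · rw [partSize, h.sum_lowerDiag h2]
    refine Finset.sum_congr rfl fun k _ => ?_
    split_ifs <;> dsimp only <;> omega

lemma IsStrict.numComponents_eq_sum (h : π.IsStrict) {N : ℕ} (h1 : π.part 0 N = 0)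
    (h2 : π.part N 0 = 0) :
    numComponents π.part =
      ∑ c ∈ Finset.range N, (π.upperDiag c \ π.upperDiag (c + 1)).card +
      ∑ c ∈ Finset.range N, (π.lowerDiag (c + 1) \ π.lowerDiag c).card := by
  classical
  rw [h.numComponents_eq, ← finsum_one, finsum_mem_def]
  have hind : ∀ p, (Set.indicator {p | IsEnd π.part p} (fun _ => 1) p : ℕ) =
      if IsEnd π.part p then 1 else 0 := fun p => by simp [Set.indicator_apply]
  simp_rw [hind]
  rw [finsum_eq_sum_diagonals (M := N) fun p hp =>
    lt_of_part_ne_zero h1 h2 (by by_contra h0; exact hp (if_neg fun he => he.1 h0))]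
  have hcard : ∀ S T : Finset ℕ, (S \ T).card = ∑ u ∈ S, if u ∉ T then 1 else 0 := fun S T => by
    rw [← Finset.filter_notMem_eq_sdiff, Finset.card_filter]
  congr 1 <;> refine Finset.sum_congr rfl fun c _ => ?_
  · rw [hcard, h.sum_upperDiag h1]
    refine Finset.sum_congr rfl fun k _ => ?_
    by_cases h0 : π.part k (k + c) = 0
    · rw [if_neg fun he => he.1 h0, if_neg (not_not.2 h0)]
    · rw [if_pos h0]
      simp only [h.isEnd_upper h0]
  · rw [hcard, h.sum_lowerDiag h2]
    refine Finset.sum_congr rfl fun k _ => ?_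
    by_cases h0 : π.part (k + (c + 1)) k = 0
    · rw [if_neg fun he => he.1 h0, if_neg (not_not.2 h0)]
    · rw [if_pos h0]
      simp only [h.isEnd_lower h0]

/-- The weight of a strict plane partition restricted to those whose support lies in an `N × N`
square, factored through the two sequences of diagonals. -/
lemma IsStrict.chainWeight_mul_eq (h : π.IsStrict) {x s : ℝ} (hx : 0 ≤ x) (hs : 0 ≤ s) (N : ℕ)
    [Decidable (π.part 0 N = 0 ∧ π.part N 0 = 0)] :
    chainWeight 1 2 s N 1 π.lowerDiag * chainWeight 2 1 s N (x * s) π.upperDiag =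
      if π.part 0 N = 0 ∧ π.part N 0 = 0 then
        ENNReal.ofReal (2 ^ numComponents π.part * x ^ π.trace * s ^ π.weight) else 0 := by
  split_ifs with hN
  · obtain ⟨h1, h2⟩ := hN
    have hup := h.isInterlacingChain_upperDiag.2 h1
    have hsum := Finset.sum_range_succ' (fun c => partSize (π.upperDiag c)) N
    rw [Finset.sum_range_succ, hup.2 N le_rfl] at hsum
    rw [chainWeight_of_isInterlacingChain zero_le_one zero_le_two hs zero_le_one
        (h.isInterlacingChain_lowerDiag.2 h2),
      chainWeight_of_isInterlacingChain zero_le_two zero_le_one hs (mul_nonneg hx hs) hup,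
      ← ENNReal.ofReal_mul (by positivity), h.numComponents_eq_sum h1 h2, h.trace_eq h1,
      h.weight_eq h1 h2, show ∑ c ∈ Finset.range N, partSize (π.upperDiag c) = _ from hsum]
    congr 1
    simp only [one_pow, one_mul, mul_one]
    ring
  · rw [not_and_or] at hN
    rcases hN with h1 | h2
    · rw [chainWeight_of_not_isInterlacingChain (mt h.isInterlacingChain_upperDiag.1 h1), mul_zero]
    · rw [chainWeight_of_not_isInterlacingChain (mt h.isInterlacingChain_lowerDiag.1 h2), zero_mul]

end PlanePartition

/-- The generating function of the strict plane partitions supported in an `N × N` square. -/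
lemma tsum_chainWeight_diag {x s : ℝ} (hx0 : 0 ≤ x) (hx1 : x < 1) (hs0 : 0 ≤ s) (hs1 : s < 1)
    (N : ℕ) :
    ∑' π : {π : PlanePartition // π.IsStrict},
        chainWeight 1 2 s N 1 π.1.lowerDiag * chainWeight 2 1 s N (x * s) π.1.upperDiag =
      ∏ i ∈ Finset.range N, ∏ j ∈ Finset.range N, macFactor (x * s ^ (i + j + 1)) := by
  classical
  have key := tsum_chainWeight_mul hs0 hs1.le N N (mul_nonneg hx0 hs0) zero_le_one
    (show x * s * 1 < 1 by nlinarith)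
  simp_rw [← ENNReal.tsum_mul_right] at key
  rw [← ENNReal.tsum_prod (f := fun f g => (if g 0 = f 0 then 1 else 0) *
    chainWeight 1 2 s N 1 g * chainWeight 2 1 s N (x * s) f)] at key
  have e : ∀ i j, x * s * 1 * s ^ (i + j) = x * s ^ (i + j + 1) := fun i j => by ring
  simp_rw [e] at key
  rw [← key]
  have hinj : Function.Injective fun π : {π : PlanePartition // π.IsStrict} =>
      (π.1.upperDiag, π.1.lowerDiag) := fun π ρ h => Subtype.ext
    (PlanePartition.diag_injective π.2 ρ.2 (Prod.mk.inj h).1 (Prod.mk.inj h).2)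
  rw [← hinj.tsum_eq]
  · refine tsum_congr fun π => ?_
    have h0 : π.1.lowerDiag 0 = π.1.upperDiag 0 := rfl
    simp only [h0, if_true, one_mul]
  · rintro ⟨f, g⟩ hfg
    have h0 : g 0 = f 0 := by
      by_contra h
      exact hfg (by simp [h])
    have hf : IsInterlacingChain N f := by
      by_contra h
      exact hfg (by simp [chainWeight_of_not_isInterlacingChain h])
    have hg : IsInterlacingChain N g := by
      by_contra h
      exact hfg (by simp [chainWeight_of_not_isInterlacingChain h])
    obtain ⟨π, hπ, hu, hl⟩ := PlanePartition.exists_diag_eq hf hg h0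
    exact ⟨⟨π, hπ⟩, by rw [← hu, ← hl]⟩

lemma prod_range_pow_succ (φ : ℕ → ℝ≥0∞) (M : ℕ) :
    ∏ n ∈ Finset.range M, φ n ^ (n + 1) =
      ∏ p ∈ (Finset.range M ×ˢ Finset.range M).filter (fun p => p.1 + p.2 < M),
        φ (p.1 + p.2) := by
  rw [← Finset.prod_fiberwise_of_maps_to (g := fun p : ℕ × ℕ => p.1 + p.2)
    (t := Finset.range M) fun p hp => Finset.mem_range.2 (Finset.mem_filter.1 hp).2]
  refine Finset.prod_congr rfl fun n hn => ?_
  have hn := Finset.mem_range.1 hn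
  have hset : ((Finset.range M ×ˢ Finset.range M).filter (fun p => p.1 + p.2 < M)).filter
      (fun p => p.1 + p.2 = n) = Finset.HasAntidiagonal.antidiagonal n := by
    ext p
    simp only [Finset.mem_filter, Finset.mem_product, Finset.mem_range, Finset.HasAntidiagonal.mem_antidiagonal]
    omega
  rw [hset, Finset.prod_congr rfl fun p hp => congrArg φ (Finset.HasAntidiagonal.mem_antidiagonal.1 hp),
    Finset.prod_const, Finset.Nat.card_antidiagonal]

lemma prod_range_pow_succ_le {φ : ℕ → ℝ≥0∞} (hφ : ∀ n, 1 ≤ φ n) (N : ℕ) :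
    ∏ n ∈ Finset.range N, φ n ^ (n + 1) ≤
      ∏ i ∈ Finset.range N, ∏ j ∈ Finset.range N, φ (i + j) := by
  rw [prod_range_pow_succ, ← Finset.prod_product (f := fun p : ℕ × ℕ => φ (p.1 + p.2))]
  exact Finset.prod_le_prod_of_subset_of_one_le' (Finset.filter_subset _ _) fun _ _ _ => hφ _

lemma prod_prod_le_prod_range {φ : ℕ → ℝ≥0∞} (hφ : ∀ n, 1 ≤ φ n) (N : ℕ) :
    ∏ i ∈ Finset.range N, ∏ j ∈ Finset.range N, φ (i + j) ≤
      ∏ n ∈ Finset.range (2 * N), φ n ^ (n + 1) := by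
  rw [prod_range_pow_succ, ← Finset.prod_product (f := fun p : ℕ × ℕ => φ (p.1 + p.2))]
  refine Finset.prod_le_prod_of_subset_of_one_le' (fun p hp => ?_) fun _ _ _ => hφ _
  simp only [Finset.mem_filter, Finset.mem_product, Finset.mem_range] at hp ⊢
  omega

lemma one_le_div_of_mem {a : ℝ} (h0 : 0 ≤ a) (h1 : a < 1) : 1 ≤ (1 + a) / (1 - a) := by
  rw [one_le_div (by linarith)]
  linarith

lemma mul_pow_succ_lt_one {x s : ℝ} (hx1 : x < 1) (hs0 : 0 ≤ s) (hs1 : s < 1) (hx0 : 0 ≤ x)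
    (n : ℕ) : x * s ^ (n + 1) < 1 :=
  (mul_le_of_le_one_right hx0 (pow_le_one₀ hs0 hs1.le)).trans_lt hx1

/-- The infinite product of the shifted MacMahon formula converges. -/
lemma multipliable_shifted_macmahon {x s : ℝ} (hx0 : 0 ≤ x) (hx1 : x < 1) (hs0 : 0 ≤ s)
    (hs1 : s < 1) :
    Multipliable fun n : ℕ => ((1 + x * s ^ (n + 1)) / (1 - x * s ^ (n + 1))) ^ (n + 1) := by
  have ha0 : ∀ n : ℕ, 0 ≤ x * s ^ (n + 1) := fun n => by positivity
  have hone : ∀ n : ℕ, 1 ≤ (1 + x * s ^ (n + 1)) / (1 - x * s ^ (n + 1)) := fun n =>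
    one_le_div_of_mem (ha0 n) (mul_pow_succ_lt_one hx1 hs0 hs1 hx0 n)
  refine Real.multipliable_of_summable_log (fun n => pow_pos (one_pos.trans_le (hone n)) _) ?_
  have hsum : Summable fun n : ℕ => 2 / (1 - x) * (((n + 1 : ℕ) : ℝ) ^ 1 * s ^ (n + 1)) :=
    ((summable_nat_add_iff (f := fun n : ℕ => (n : ℝ) ^ 1 * s ^ n) 1).2 (summable_pow_mul_geometric_of_norm_lt_one 1
      (by rwa [Real.norm_of_nonneg hs0]))).mul_left _
  refine hsum.of_nonneg_of_le (fun n => Real.log_nonneg (one_le_pow₀ (hone n))) fun n => ?_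
  rw [Real.log_pow, pow_one, mul_left_comm]
  refine mul_le_mul_of_nonneg_left ?_ (Nat.cast_nonneg _)
  have hlt := mul_pow_succ_lt_one hx1 hs0 hs1 hx0 n
  have hle : x * s ^ (n + 1) ≤ x := mul_le_of_le_one_right hx0 (pow_le_one₀ hs0 hs1.le)
  have hle' : x * s ^ (n + 1) ≤ s ^ (n + 1) := mul_le_of_le_one_left (by positivity) hx1.le
  calc Real.log ((1 + x * s ^ (n + 1)) / (1 - x * s ^ (n + 1)))
      ≤ (1 + x * s ^ (n + 1)) / (1 - x * s ^ (n + 1)) - 1 :=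
        Real.log_le_sub_one_of_pos (one_pos.trans_le (hone n))
    _ = 2 * (x * s ^ (n + 1)) / (1 - x * s ^ (n + 1)) := by
        rw [div_sub_one (by linarith)]
        ring
    _ ≤ 2 * s ^ (n + 1) / (1 - x) :=
        div_le_div₀ (by positivity) (by linarith) (by linarith) (by linarith)
    _ = 2 / (1 - x) * s ^ (n + 1) := by ring

/-- The shifted MacMahon formula in the extended nonnegative reals. -/
lemma tsum_ofReal_shifted_macmahon {x s : ℝ} (hx0 : 0 ≤ x) (hx1 : x < 1) (hs0 : 0 ≤ s)
    (hs1 : s < 1) :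
    ∑' π : {π : PlanePartition // π.IsStrict},
        ENNReal.ofReal (2 ^ numComponents π.1.part * x ^ π.1.trace * s ^ π.1.weight) =
      ENNReal.ofReal
        (∏' n : ℕ, ((1 + x * s ^ (n + 1)) / (1 - x * s ^ (n + 1))) ^ (n + 1)) := by
  classical
  have hone : ∀ n : ℕ, 1 ≤ (1 + x * s ^ (n + 1)) / (1 - x * s ^ (n + 1)) := fun n =>
    one_le_div_of_mem (by positivity) (mul_pow_succ_lt_one hx1 hs0 hs1 hx0 n)
  let φ : ℕ → ℝ≥0∞ := fun n => macFactor (x * s ^ (n + 1))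
  have hφ : ∀ n, 1 ≤ φ n := fun n => ENNReal.one_le_ofReal.2 (hone n)
  have hbox := tsum_chainWeight_diag hx0 hx1 hs0 hs1
  simp_rw [fun (N : ℕ) (π : {π : PlanePartition // π.IsStrict}) =>
    π.2.chainWeight_mul_eq hx0 hs0 N] at hbox
  have hlim : Filter.Tendsto (fun N => ∏ n ∈ Finset.range N, φ n ^ (n + 1)) Filter.atTop
      (nhds (ENNReal.ofReal
        (∏' n : ℕ, ((1 + x * s ^ (n + 1)) / (1 - x * s ^ (n + 1))) ^ (n + 1)))) := by
    refine (ENNReal.tendsto_ofReal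
      (multipliable_shifted_macmahon hx0 hx1 hs0 hs1).hasProd.tendsto_prod_nat).congr fun N => ?_
    rw [ENNReal.ofReal_prod_of_nonneg fun n _ => pow_nonneg (zero_le_one.trans (hone n)) _]
    exact Finset.prod_congr rfl fun n _ => ENNReal.ofReal_pow (zero_le_one.trans (hone n)) _
  have hmono : Monotone fun N => ∏ n ∈ Finset.range N, φ n ^ (n + 1) := fun M N hMN =>
    Finset.prod_le_prod_of_subset_of_one_le' (Finset.range_subset_range.2 hMN)
      fun n _ _ => one_le_pow₀ (hφ n)
  refine le_antisymm ?_ ?_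
  · rw [ENNReal.tsum_eq_iSup_sum]
    refine iSup_le fun F => ?_
    choose M hM using fun π : {π : PlanePartition // π.IsStrict} => π.1.exists_part_eq_zero
    calc ∑ π ∈ F, ENNReal.ofReal (2 ^ numComponents π.1.part * x ^ π.1.trace * s ^ π.1.weight)
        = ∑ π ∈ F, if π.1.part 0 (F.sup M) = 0 ∧ π.1.part (F.sup M) 0 = 0 then
            ENNReal.ofReal (2 ^ numComponents π.1.part * x ^ π.1.trace * s ^ π.1.weight)
            else 0 :=
          Finset.sum_congr rfl fun π hπ => (if_pos (hM π _ (Finset.le_sup hπ))).symm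
      _ ≤ ∏ i ∈ Finset.range (F.sup M), ∏ j ∈ Finset.range (F.sup M), φ (i + j) :=
          (ENNReal.sum_le_tsum F).trans (hbox _).le
      _ ≤ ∏ n ∈ Finset.range (2 * F.sup M), φ n ^ (n + 1) := prod_prod_le_prod_range hφ _
      _ ≤ _ := hmono.ge_of_tendsto hlim _
  · refine le_of_tendsto' hlim fun N => (prod_range_pow_succ_le hφ N).trans ?_
    refine (hbox N).ge.trans (ENNReal.tsum_le_tsum fun π => ?_)
    split_ifs
    · exact le_rfl
    · exact zero_le

/-- **Generalized shifted MacMahon's formula (full version).**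
`∑_{π ∈ SP} 2^{k(π)} x^{tr(π)} s^{|π|} = ∏_{n=1}^{∞} [ (1 + x sⁿ) / (1 - x sⁿ) ]ⁿ`,
the sum being over all strict plane partitions, for real `0 ≤ x, s < 1`. -/
theorem generalized_shifted_macmahon
    (x s : ℝ) (hx0 : 0 ≤ x) (hx1 : x < 1) (hs0 : 0 ≤ s) (hs1 : s < 1) :
    ∑' π : {π : PlanePartition // π.IsStrict},
        (2 : ℝ) ^ numComponents π.1.part * x ^ π.1.trace * s ^ π.1.weight =
      ∏' n : ℕ, ((1 + x * s ^ (n + 1)) / (1 - x * s ^ (n + 1))) ^ (n + 1) := by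
  have hnonneg : ∀ π : {π : PlanePartition // π.IsStrict},
      0 ≤ (2 : ℝ) ^ numComponents π.1.part * x ^ π.1.trace * s ^ π.1.weight :=
    fun π => by positivity
  have hpos : 0 ≤ ∏' n : ℕ, ((1 + x * s ^ (n + 1)) / (1 - x * s ^ (n + 1))) ^ (n + 1) :=
    ge_of_tendsto' (multipliable_shifted_macmahon hx0 hx1 hs0 hs1).hasProd.tendsto_prod_nat
      fun N => Finset.prod_nonneg fun n _ => pow_nonneg (zero_le_one.trans
        (one_le_div_of_mem (by positivity) (mul_pow_succ_lt_one hx1 hs0 hs1 hx0 n))) _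
  have h := congrArg ENNReal.toReal (tsum_ofReal_shifted_macmahon hx0 hx1 hs0 hs1)
  rw [ENNReal.tsum_toReal_eq fun _ => ENNReal.ofReal_ne_top, ENNReal.toReal_ofReal hpos] at h
  rw [← h]
  exact tsum_congr fun π => (ENNReal.toReal_ofReal (hnonneg π)).symm
end
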